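/- Let r ≥ 4 and let G = (V,E) be a finite edge-weighted graph excluding K_{r+1} as a minor, and let Δ > 0. Then there is a probability distribution over partitions of V into clusters of weak diameter at most Δ such that for every vertex z ∈ V and every 0 ≤ γ ≤ 1/40, the probability that the ball B_G(z, γΔ) is cut by the partition (i.e., not contained in a single cluster) is at most 1 − e^{−80rγ}. -/

import Mathlib

open MeasureTheory Real ENNReal

namespace KPRpaper

variable {V : Type*}

/-- The total weight of a walk in an edge-weighted graph. -/
def walkWeight (w : V → V → ℝ) {G : SimpleGraph V} {x y : V} (p : G.Walk x y) : ℝ :=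
  (p.darts.map (fun d => w d.toProd.1 d.toProd.2)).sum

/-- Shortest-path distance between `x` and `y` using only walks whose vertices all
lie in the set `s` (`⊤` if there is no such walk). -/
noncomputable def dIn (G : SimpleGraph V) (w : V → V → ℝ) (s : Set V) (x y : V) : ℝ≥0∞ :=
  ⨅ p : {p : G.Walk x y // ∀ v ∈ p.support, v ∈ s}, ENNReal.ofReal (walkWeight w p.1)

/-- Shortest-path distance in the whole graph. -/
noncomputable def dG (G : SimpleGraph V) (w : V → V → ℝ) (x y : V) : ℝ≥0∞ :=
  dIn G w Set.univ x y

/-- Distance from a point to a set, within the vertex set `s`. -/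
noncomputable def dSet (G : SimpleGraph V) (w : V → V → ℝ) (s : Set V) (x : V) (A : Set V) :
    ℝ≥0∞ :=
  ⨅ a ∈ A, dIn G w s x a

/-- The ball of radius `ρ` around `z` in the shortest-path metric. -/
def gball (G : SimpleGraph V) (w : V → V → ℝ) (z : V) (ρ : ℝ) : Set V :=
  {v | dG G w z v ≤ ENNReal.ofReal ρ}

/-- The ball of radius `ρ` around the set `A`, inside the induced subgraph on `s`. -/
def gballIn (G : SimpleGraph V) (w : V → V → ℝ) (s A : Set V) (ρ : ℝ) : Set V :=
  {v | v ∈ s ∧ dSet G w s v A ≤ ENNReal.ofReal ρ}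

/-- `G` contains the complete graph `K_q` as a minor: there are `q` pairwise disjoint
nonempty vertex sets, each inducing a connected subgraph, with an edge between any two. -/
def HasCliqueMinor (G : SimpleGraph V) (q : ℕ) : Prop :=
  ∃ S : Fin q → Set V,
    (∀ i, (S i).Nonempty) ∧
    (∀ i, (G.induce (S i)).Connected) ∧
    (∀ i j, i ≠ j → Disjoint (S i) (S j)) ∧
    (∀ i j, i ≠ j → ∃ u ∈ S i, ∃ v ∈ S j, G.Adj u v)

/-- There is a walk from `x` to `y` all of whose vertices lie in `s`. -/
def ReachableIn (G : SimpleGraph V) (s : Set V) (x y : V) : Prop :=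
  ∃ p : G.Walk x y, ∀ v ∈ p.support, v ∈ s

/-- There is a walk of weight at most `ρ` from `x` to `y` all of whose vertices lie in `s`. -/
def Within {V : Type*} (G : SimpleGraph V) (w : V → V → ℝ) (s : Set V) (x y : V) (ρ : ℝ) : Prop :=
  ∃ p : G.Walk x y, (∀ v ∈ p.support, v ∈ s) ∧ walkWeight w p ≤ ρ

section Walks

variable {V : Type*} {G : SimpleGraph V} {w : V → V → ℝ} {s t : Set V} {x y z : V} {ρ σ : ℝ}

@[simp] lemma walkWeight_nil : walkWeight w (SimpleGraph.Walk.nil : G.Walk x x) = 0 := by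
  simp [walkWeight]

@[simp] lemma walkWeight_cons (h : G.Adj x y) (p : G.Walk y z) :
    walkWeight w (SimpleGraph.Walk.cons h p) = w x y + walkWeight w p := by
  simp [walkWeight]

lemma walkWeight_append (p : G.Walk x y) (q : G.Walk y z) :
    walkWeight w (p.append q) = walkWeight w p + walkWeight w q := by
  simp [walkWeight]

lemma walkWeight_reverse (hws : ∀ u v, w u v = w v u) (p : G.Walk x y) :
    walkWeight w p.reverse = walkWeight w p := by
  induction p with
  | nil => simp
  | cons h p ih =>
    rw [SimpleGraph.Walk.reverse_cons, walkWeight_append, ih]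
    simp [hws, add_comm]

lemma walkWeight_nonneg (hw : ∀ u v, G.Adj u v → 0 < w u v) (p : G.Walk x y) :
    0 ≤ walkWeight w p := by
  induction p with
  | nil => simp
  | cons h p ih => simp only [walkWeight_cons]; linarith [hw _ _ h]

lemma walkWeight_bypass_le [DecidableEq V] (hw : ∀ u v, G.Adj u v → 0 < w u v)
    (p : G.Walk x y) : walkWeight w p.bypass ≤ walkWeight w p := by
  refine List.Sublist.sum_le_sum ((p.darts_bypass_sublist_darts).map _) ?_
  intro a ha
  obtain ⟨d, -, rfl⟩ := List.mem_map.1 ha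
  exact (hw _ _ d.adj).le

lemma Within.refl (h : x ∈ s) (hρ : 0 ≤ ρ) : Within G w s x x ρ :=
  ⟨.nil, by simpa using h, by simpa using hρ⟩

lemma Within.mono (h : Within G w s x y ρ) (hst : s ⊆ t) (hρ : ρ ≤ σ) : Within G w t x y σ := by
  obtain ⟨p, hp, h⟩ := h
  exact ⟨p, fun v hv => hst (hp v hv), h.trans hρ⟩

lemma Within.trans (h : Within G w s x y ρ) (h' : Within G w s y z σ) :
    Within G w s x z (ρ + σ) := by
  obtain ⟨p, hp, h⟩ := h
  obtain ⟨q, hq, h'⟩ := h'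
  refine ⟨p.append q, fun v hv => ?_, ?_⟩
  · rcases SimpleGraph.Walk.mem_support_append_iff _ _ |>.1 hv with hv | hv
    exacts [hp v hv, hq v hv]
  · rw [walkWeight_append]; linarith

lemma Within.symm (hws : ∀ u v, w u v = w v u) (h : Within G w s x y ρ) :
    Within G w s y x ρ := by
  obtain ⟨p, hp, h⟩ := h
  exact ⟨p.reverse, by simpa using hp, by rwa [walkWeight_reverse hws]⟩

lemma Within.edge (h : G.Adj x y) (hx : x ∈ s) (hy : y ∈ s) : Within G w s x y (w x y) :=
  ⟨.cons h .nil, by simp [hx, hy], by simp⟩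

lemma Within.nonneg (hw : ∀ u v, G.Adj u v → 0 < w u v) (h : Within G w s x y ρ) : 0 ≤ ρ := by
  obtain ⟨p, -, h⟩ := h
  exact (walkWeight_nonneg hw p).trans h

lemma Within.left_mem (h : Within G w s x y ρ) : x ∈ s := by
  obtain ⟨p, hp, -⟩ := h
  exact hp _ p.start_mem_support

lemma Within.right_mem (h : Within G w s x y ρ) : y ∈ s := by
  obtain ⟨p, hp, -⟩ := h
  exact hp _ p.end_mem_support

lemma Within.reachableIn (h : Within G w s x y ρ) : ReachableIn G s x y := by
  obtain ⟨p, hp, -⟩ := h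
  exact ⟨p, hp⟩

lemma ReachableIn.exists_within (w : V → V → ℝ) (h : ReachableIn G s x y) :
    ∃ ρ, Within G w s x y ρ := by
  obtain ⟨p, hp⟩ := h
  exact ⟨_, p, hp, le_rfl⟩

lemma ReachableIn.refl (h : x ∈ s) : ReachableIn G s x x := ⟨.nil, by simpa using h⟩

lemma ReachableIn.mono (h : ReachableIn G s x y) (hst : s ⊆ t) : ReachableIn G t x y := by
  obtain ⟨p, hp⟩ := h
  exact ⟨p, fun v hv => hst (hp v hv)⟩

lemma ReachableIn.trans (h : ReachableIn G s x y) (h' : ReachableIn G s y z) :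
    ReachableIn G s x z := by
  obtain ⟨p, hp⟩ := h
  obtain ⟨q, hq⟩ := h'
  refine ⟨p.append q, fun v hv => ?_⟩
  rcases SimpleGraph.Walk.mem_support_append_iff _ _ |>.1 hv with hv | hv
  exacts [hp v hv, hq v hv]

lemma ReachableIn.symm (h : ReachableIn G s x y) : ReachableIn G s y x := by
  obtain ⟨p, hp⟩ := h
  exact ⟨p.reverse, by simpa using hp⟩

lemma ReachableIn.edge (h : G.Adj x y) (hx : x ∈ s) (hy : y ∈ s) : ReachableIn G s x y :=
  ⟨.cons h .nil, by simp [hx, hy]⟩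

lemma ReachableIn.left_mem (h : ReachableIn G s x y) : x ∈ s := by
  obtain ⟨p, hp⟩ := h
  exact hp _ p.start_mem_support

lemma ReachableIn.right_mem (h : ReachableIn G s x y) : y ∈ s := by
  obtain ⟨p, hp⟩ := h
  exact hp _ p.end_mem_support

/-- A walk inside `s` that leaves `C` uses an edge leaving `C` after an initial part inside `C`. -/
lemma Within.exit {C : Set V} (h : Within G w s x y ρ) (hx : x ∈ C) (hy : y ∉ C) :
    ∃ u v α β, Within G w (s ∩ C) x u α ∧ u ∈ C ∧ v ∉ C ∧ v ∈ s ∧ G.Adj u v ∧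
      Within G w s v y β ∧ α + w u v + β = ρ := by
  obtain ⟨p, hp, h⟩ := h
  induction p generalizing ρ with
  | nil => exact absurd hx hy
  | @cons a b c hab p ih =>
    simp only [walkWeight_cons] at h
    have ha : a ∈ s := hp _ (by simp)
    have hp' : ∀ v ∈ p.support, v ∈ s := fun v hv => hp v (by simp [hv])
    by_cases hb : b ∈ C
    · obtain ⟨u, v, α, β, h1, h2, h3, h4, h5, h6, h7⟩ := ih hb hy hp' (ρ := ρ - w a b) (by linarith)
      refine ⟨u, v, w a b + α, β, ?_, h2, h3, h4, h5, h6, by linarith⟩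
      exact Within.trans (y := b) (Within.edge hab (Set.mem_inter ha hx) h1.left_mem) h1
    · refine ⟨a, b, 0, ρ - w a b, Within.refl ⟨ha, hx⟩ le_rfl, hx, hb,
        hp' _ p.start_mem_support, hab, ⟨p, hp', by linarith⟩, by ring⟩

lemma ReachableIn.exit {C : Set V} (h : ReachableIn G s x y) (hx : x ∈ C) (hy : y ∉ C) :
    ∃ u v, ReachableIn G (s ∩ C) x u ∧ u ∈ C ∧ v ∉ C ∧ v ∈ s ∧ G.Adj u v := by
  obtain ⟨ρ, h⟩ := h.exists_within (0 : V → V → ℝ)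
  obtain ⟨u, v, α, β, h1, h2, h3, h4, h5, -, -⟩ := h.exit hx hy
  exact ⟨u, v, h1.reachableIn, h2, h3, h4, h5⟩

/-- A walk inside `s` starting in a set `D` that is closed in `s` under adjacency stays in `D`. -/
lemma Within.of_closed {D : Set V} (h : Within G w s x y ρ) (hx : x ∈ D)
    (hD : ∀ u ∈ D, ∀ v, G.Adj u v → v ∈ s → v ∈ D) : Within G w (s ∩ D) x y ρ := by
  obtain ⟨p, hp, h⟩ := h
  refine ⟨p, ?_, h⟩
  clear h
  induction p with
  | nil => intro v hv; refine ⟨hp v hv, ?_⟩; simp at hv; rwa [hv]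
  | @cons a b c hab p ih =>
    intro v hv
    have hp' : ∀ v ∈ p.support, v ∈ s := fun v hv => hp v (by simp [hv])
    have hb := hD a hx b hab (hp' _ p.start_mem_support)
    rw [SimpleGraph.Walk.support_cons, List.mem_cons] at hv
    rcases hv with rfl | hv
    · exact ⟨hp _ (by simp), hx⟩
    · exact ih hb hp' v hv

lemma ReachableIn.of_closed {D : Set V} (h : ReachableIn G s x y) (hx : x ∈ D)
    (hD : ∀ u ∈ D, ∀ v, G.Adj u v → v ∈ s → v ∈ D) : ReachableIn G (s ∩ D) x y := by
  obtain ⟨ρ, h⟩ := h.exists_within (0 : V → V → ℝ)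
  exact (h.of_closed hx hD).reachableIn

/-- Splitting a walk at one of its vertices. -/
lemma walk_split (p : G.Walk x y) (hz : z ∈ p.support) :
    ∃ (p1 : G.Walk x z) (p2 : G.Walk z y), p = p1.append p2 := by
  classical
  exact ⟨p.takeUntil z hz, p.dropUntil z hz, (p.take_spec hz).symm⟩

/-- A shortest walk inside `s` exists as soon as some walk inside `s` exists. -/
lemma exists_shortest_walk [Finite V] (hw : ∀ u v, G.Adj u v → 0 < w u v)
    (h : ReachableIn G s x y) :
    ∃ p : G.Walk x y, (∀ v ∈ p.support, v ∈ s) ∧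
      ∀ q : G.Walk x y, (∀ v ∈ q.support, v ∈ s) → walkWeight w p ≤ walkWeight w q := by
  classical
  have := Fintype.ofFinite V
  let S : Set (G.Walk x y) := {p | p.IsPath ∧ ∀ v ∈ p.support, v ∈ s}
  have hfin : S.Finite := by
    have : {p : G.Walk x y | p.IsPath}.Finite := by
      refine Set.Finite.subset (Set.Finite.biUnion (Set.finite_lt_nat (Fintype.card V))
        (t := fun n => {p : G.Walk x y | p.IsPath ∧ p.length = n}) (fun n _ => Set.toFinite _)) ?_
      intro p hp
      simp only [Set.mem_iUnion]
      exact ⟨p.length, SimpleGraph.Walk.IsPath.length_lt hp, hp, rfl⟩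
    exact this.subset fun p hp => hp.1
  have hby : ∀ q : G.Walk x y, (∀ v ∈ q.support, v ∈ s) → q.bypass ∈ S := fun q hq =>
    ⟨q.bypass_isPath, fun v hv => hq v (q.support_bypass_subset_support hv)⟩
  obtain ⟨q0, hq0⟩ := h
  obtain ⟨p, hp, hmin⟩ := Set.exists_min_image S (walkWeight w) hfin ⟨_, hby q0 hq0⟩
  exact ⟨p, hp.2, fun q hq => (hmin _ (hby q hq)).trans (walkWeight_bypass_le hw q)⟩

lemma ReachableIn.isLeast [Finite V] (hw : ∀ u v, G.Adj u v → 0 < w u v)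
    (h : ReachableIn G s x y) : ∃ d, IsLeast {ρ | Within G w s x y ρ} d := by
  obtain ⟨p, hp, hmin⟩ := exists_shortest_walk hw h
  refine ⟨walkWeight w p, ⟨p, hp, le_rfl⟩, ?_⟩
  rintro ρ ⟨q, hq, hρ⟩
  exact (hmin q hq).trans hρ

lemma dIn_le_iff [Finite V] (hw : ∀ u v, G.Adj u v → 0 < w u v) (hρ : 0 ≤ ρ) :
    dIn G w s x y ≤ ENNReal.ofReal ρ ↔ Within G w s x y ρ := by
  constructor
  · intro h
    by_cases hr : ReachableIn G s x y
    · obtain ⟨p, hp, hmin⟩ := exists_shortest_walk hw hr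
      refine ⟨p, hp, ?_⟩
      have : ENNReal.ofReal (walkWeight w p) ≤ dIn G w s x y :=
        le_iInf fun q => ENNReal.ofReal_le_ofReal (hmin q.1 q.2)
      exact (ENNReal.ofReal_le_ofReal_iff hρ).1 (this.trans h)
    · exfalso
      have : IsEmpty {p : G.Walk x y // ∀ v ∈ p.support, v ∈ s} := ⟨fun p => hr ⟨p.1, p.2⟩⟩
      rw [dIn, iInf_of_empty] at h
      exact absurd h (by simp)
  · rintro ⟨p, hp, h⟩
    exact (iInf_le _ (⟨p, hp⟩ : {p : G.Walk x y // ∀ v ∈ p.support, v ∈ s})).trans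
      (ENNReal.ofReal_le_ofReal h)

end Walks

/-- The labels of the vertices outside `C` that have a neighbour in `C`. -/
def bdryLabels {V : Type*} (G : SimpleGraph V) (o : V → ℕ) (C : Set V) : Set ℕ :=
  {i | ∃ u ∈ C, ∃ v, v ∉ C ∧ G.Adj u v ∧ o v = i}

/-- The part of `C` reachable from `z` through labels at least `b` has a neighbour labelled `i`. -/
def AdjLabel {V : Type*} (G : SimpleGraph V) (o : V → ℕ) (C : Set V) (b : ℕ) (z : V) (i : ℕ) :
    Prop :=
  ∃ u p, ReachableIn G {x | x ∈ C ∧ b ≤ o x} z u ∧ G.Adj u p ∧ o p = i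

/-- An edge leaves `C` from a vertex close to `z` towards a label exceeding `a`, in total
length at most `δ`. -/
def NearBdry {V : Type*} (G : SimpleGraph V) (w : V → V → ℝ) (o : V → ℕ) (C : Set V) (a : ℕ)
    (δ : ℝ) (z : V) : Prop :=
  ∃ u v α, Within G w C z u α ∧ v ∉ C ∧ G.Adj u v ∧ a < o v ∧ α + w u v ≤ δ

/-- The connected set `C` is still to be processed, after the vertices in `A` received labels
smaller than `n`; `N` is the set of net points, and `a` the label `C` was last separated from. -/
structure IsState {V : Type*} (G : SimpleGraph V) (w : V → V → ℝ) (r : ℕ) (δ η : ℝ)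
    (C A : Set V) (n : ℕ) (o : V → ℕ) (X : ℕ → Set V) (N : Set V) (a : ℕ) : Prop where
  nonempty : C.Nonempty
  conn : ∀ x ∈ C, ∀ y ∈ C, ReachableIn G C x y
  bdry : ∀ u ∈ C, ∀ v, v ∉ C → G.Adj u v → v ∈ X (o v)
  disj : ∀ v ∈ A, v ∉ C
  lt : ∀ v ∈ A, o v < n
  X_sub : ∀ i, ∀ v ∈ X i, v ∈ A ∧ o v = i
  X_conn : ∀ i ∈ bdryLabels G o C, ∀ x ∈ X i, ∀ y ∈ X i, ReachableIn G (X i) x y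
  X_adj : ∀ i ∈ bdryLabels G o C, ∀ j ∈ bdryLabels G o C, i ≠ j →
    ∃ x ∈ X i, ∃ y ∈ X j, G.Adj x y
  N_sub : N ⊆ A
  radius : ∀ u ∈ C, ∀ v, v ∉ C → G.Adj u v → ∃ t ∈ N, o t = o v ∧
    Within G w {x | x ∈ A ∧ o x = o v} v t
      (η + δ * (r - (bdryLabels G o C ∩ Set.Iio (o v)).ncard - if a < o v then 1 else 0))

/-- The properties of a complete labelling of `C` with its set of net points. -/
structure IsOutput {V : Type*} (G : SimpleGraph V) (w : V → V → ℝ) (r : ℕ) (δ η ρ : ℝ) (m : ℕ)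
    (C A : Set V) (n : ℕ) (N : Set V) (a : ℕ) (o : V → ℕ) (N' : Set V) : Prop where
  N_sub : ∀ t ∈ N', t ∈ C ∧ n ≤ o t
  lab : ∀ v ∈ C, n ≤ o v ∨ o v ∈ bdryLabels G o C
  near : ∀ v ∈ C, ∃ t ∈ N ∪ N', o t = o v ∧
    Within G w {x | x ∈ A ∪ C ∧ o x = o v} v t (η + δ * r)
  far : ∀ z ∈ C, n ≤ o z → ¬ NearBdry G w o C a δ z
  few : ∀ z ∈ C, ∀ b, n ≤ b → b ≤ o z → {i | i < b ∧ AdjLabel G o C b z i}.ncard < r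
  buffer : ∀ z ∈ C, n ≤ o z → ∀ i, (i ∈ bdryLabels G o C ∨ n ≤ i) → i < o z →
    ¬ AdjLabel G o C (o z) z i →
    ∃ D ⊆ C, z ∈ D ∧ (∀ v ∈ D, o v ≠ i) ∧ (∀ u ∈ D, ∀ v, G.Adj u v → o v ≠ i) ∧
      ∀ u ∈ D, ∀ v, v ∉ D → G.Adj u v → i ≤ o v → ∀ α, Within G w D z u α → δ < α + w u v
  net : ∀ z b, n ≤ b →
    {t | t ∈ N' ∧ o t = b ∧ Within G w {x | x ∈ C ∧ b ≤ o x} z t ρ}.ncard ≤ m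

section Recursion

variable {V : Type*} {G : SimpleGraph V} {w : V → V → ℝ} {r m : ℕ} {δ η ρ : ℝ}
  {C A D R : Set V} {n n1 : ℕ} {o o' : V → ℕ} {X : ℕ → Set V} {N N' Net : Set V} {a : ℕ}

lemma IsState.bdry_mem (h : IsState G w r δ η C A n o X N a) {u v : V} (hu : u ∈ C) (hv : v ∉ C)
    (huv : G.Adj u v) : v ∈ A :=
  (h.X_sub _ v (h.bdry u hu v hv huv)).1

lemma IsState.bdryLabels_lt (h : IsState G w r δ η C A n o X N a) {i : ℕ}
    (hi : i ∈ bdryLabels G o C) : i < n := by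
  obtain ⟨u, hu, v, hv, huv, rfl⟩ := hi
  exact h.lt v (h.bdry_mem hu hv huv)

lemma bdryLabels_congr (hb : ∀ u ∈ C, ∀ v, v ∉ C → G.Adj u v → v ∈ A) (ho : ∀ v ∈ A, o' v = o v) :
    bdryLabels G o' C = bdryLabels G o C := by
  ext i
  constructor
  · rintro ⟨u, hu, v, hv, huv, h⟩
    exact ⟨u, hu, v, hv, huv, by rw [← ho v (hb u hu v hv huv), h]⟩
  · rintro ⟨u, hu, v, hv, huv, h⟩
    exact ⟨u, hu, v, hv, huv, by rw [ho v (hb u hu v hv huv), h]⟩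

lemma IsState.congr (h : IsState G w r δ η C A n o X N a) (ho : ∀ v ∈ A, o' v = o v) :
    IsState G w r δ η C A n o' X N a := by
  have hK := bdryLabels_congr (o := o) (o' := o') (fun u hu v hv huv => h.bdry_mem hu hv huv) ho
  refine ⟨h.nonempty, h.conn, ?_, h.disj, ?_, ?_, ?_, ?_, h.N_sub, ?_⟩
  · intro u hu v hv huv
    rw [ho v (h.bdry_mem hu hv huv)]
    exact h.bdry u hu v hv huv
  · intro v hv
    rw [ho v hv]; exact h.lt v hv
  · intro i v hv
    have := h.X_sub i v hv
    exact ⟨this.1, by rw [ho v this.1, this.2]⟩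
  · rw [hK]; exact h.X_conn
  · rw [hK]; exact h.X_adj
  · intro u hu v hv huv
    obtain ⟨t, ht, h1, h2⟩ := h.radius u hu v hv huv
    have hvo := ho v (h.bdry_mem hu hv huv)
    refine ⟨t, ht, by rw [ho t (h.N_sub ht), hvo, h1], ?_⟩
    rw [hK, hvo]
    refine h2.mono ?_ le_rfl
    rintro x ⟨hx, hx'⟩
    exact ⟨hx, by rw [ho x hx, hx']⟩

lemma IsOutput.congr (h : IsOutput G w r δ η ρ m C A n N a o N') (hN : N ⊆ A)
    (hb : ∀ u ∈ C, ∀ v, v ∉ C → G.Adj u v → v ∈ A) (ho : ∀ v ∈ A ∪ C, o' v = o v) :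
    IsOutput G w r δ η ρ m C A n N a o' N' := by
  have hK := bdryLabels_congr (o := o) (o' := o') hb (fun v hv => ho v (Or.inl hv))
  have hC : ∀ v ∈ C, o' v = o v := fun v hv => ho v (Or.inr hv)
  have hadj : ∀ u ∈ C, ∀ v, G.Adj u v → o' v = o v := by
    intro u hu v huv
    by_cases hv : v ∈ C
    · exact hC v hv
    · exact ho v (Or.inl (hb u hu v hv huv))
  have hset : ∀ b, {x | x ∈ C ∧ b ≤ o' x} = {x | x ∈ C ∧ b ≤ o x} := by
    intro b; ext x
    constructor <;> rintro ⟨h1, h2⟩ <;> refine ⟨h1, ?_⟩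
    · rwa [← hC x h1]
    · rwa [hC x h1]
  have hal : ∀ b z i, AdjLabel G o' C b z i ↔ AdjLabel G o C b z i := by
    intro b z i
    unfold AdjLabel
    rw [hset]
    constructor <;> rintro ⟨u, p, h1, h2, h3⟩ <;> refine ⟨u, p, h1, h2, ?_⟩
    · rw [← hadj u h1.right_mem.1 p h2, h3]
    · rw [hadj u h1.right_mem.1 p h2, h3]
  refine ⟨?_, ?_, ?_, ?_, ?_, ?_, ?_⟩
  · intro t ht
    have := h.N_sub t ht
    exact ⟨this.1, by rw [hC t this.1]; exact this.2⟩
  · intro v hv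
    rw [hK, hC v hv]; exact h.lab v hv
  · intro v hv
    obtain ⟨t, ht, h1, h2⟩ := h.near v hv
    have hto : o' t = o t := by
      rcases ht with ht | ht
      · exact ho t (Or.inl (hN ht))
      · exact hC t (h.N_sub t ht).1
    refine ⟨t, ht, by rw [hto, hC v hv, h1], ?_⟩
    rw [hC v hv]
    refine h2.mono ?_ le_rfl
    rintro x ⟨hx, hx'⟩
    exact ⟨hx, by rw [ho x hx, hx']⟩
  · rintro z hz hn ⟨u, v, α, h1, h2, h3, h4, h5⟩
    rw [hC z hz] at hn
    rw [hadj u h1.right_mem v h3] at h4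
    exact h.far z hz hn ⟨u, v, α, h1, h2, h3, h4, h5⟩
  · intro z hz b hn hbz
    rw [hC z hz] at hbz
    simp only [hal]
    exact h.few z hz b hn hbz
  · intro z hz hn i hi hiz hna
    rw [hC z hz] at hn hiz hna
    rw [hK] at hi
    rw [hal] at hna
    obtain ⟨D, hDC, hzD, h1, h2, h3⟩ := h.buffer z hz hn i hi hiz hna
    refine ⟨D, hDC, hzD, fun v hv => ?_, fun u hu v huv => ?_, fun u hu v hv huv hiv => ?_⟩
    · rw [hC v (hDC hv)]; exact h1 v hv
    · rw [hadj u (hDC hu) v huv]; exact h2 u hu v huv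
    · rw [hadj u (hDC hu) v huv] at hiv; exact h3 u hu v hv huv hiv
  · intro z b hb
    rw [hset]
    have : {t | t ∈ N' ∧ o' t = b ∧ Within G w {x | x ∈ C ∧ b ≤ o x} z t ρ} =
        {t | t ∈ N' ∧ o t = b ∧ Within G w {x | x ∈ C ∧ b ≤ o x} z t ρ} := by
      ext t
      constructor <;> rintro ⟨h1, h2, h3⟩ <;> refine ⟨h1, ?_, h3⟩
      · rw [← hC t (h.N_sub t h1).1, h2]
      · rw [hC t (h.N_sub t h1).1, h2]
    rw [this]
    exact h.net z b hb

/-- The connected components of the subgraph induced on `s`. -/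
def comps (G : SimpleGraph V) (s : Set V) : Set (Set V) :=
  {D | ∃ x ∈ s, D = {v | ReachableIn G s x v}}

lemma comps_sub {s : Set V} (hD : D ∈ comps G s) : D ⊆ s := by
  obtain ⟨x, hx, rfl⟩ := hD
  exact fun v hv => hv.right_mem

lemma comps_eq {s : Set V} (hD : D ∈ comps G s) {v : V} (hv : v ∈ D) :
    D = {u | ReachableIn G s v u} := by
  obtain ⟨x, hx, rfl⟩ := hD
  ext u
  exact ⟨fun hu => (ReachableIn.symm hv).trans hu, fun hu => ReachableIn.trans hv hu⟩

lemma comps_nonempty {s : Set V} (hD : D ∈ comps G s) : D.Nonempty := by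
  obtain ⟨x, hx, rfl⟩ := hD
  exact ⟨x, ReachableIn.refl hx⟩

lemma comps_closed {s : Set V} (hD : D ∈ comps G s) {u v : V} (hu : u ∈ D) (huv : G.Adj u v)
    (hv : v ∈ s) : v ∈ D := by
  obtain ⟨x, hx, rfl⟩ := hD
  exact ReachableIn.trans hu (ReachableIn.edge huv hu.right_mem hv)

lemma comps_conn {s : Set V} (hD : D ∈ comps G s) {u v : V} (hu : u ∈ D) (hv : v ∈ D) :
    ReachableIn G D u v := by
  have h : ReachableIn G s u v := by
    rw [comps_eq hD hu] at hv; exact hv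
  exact (h.of_closed hu fun x hx y hxy hy => comps_closed hD hx hxy hy).mono
    Set.inter_subset_right

lemma mem_comps {s : Set V} {z : V} (hz : z ∈ s) : {v | ReachableIn G s z v} ∈ comps G s :=
  ⟨z, hz, rfl⟩

/-- Outputs on the components of `C \ R` combine to an output on `C`. -/
lemma IsState.glue [Finite V] (h : IsState G w r δ η C A n o X N a)
    (hK : (bdryLabels G o C).ncard < r)
    (hRC : R ⊆ C) (hlt : ∀ v ∈ R, o v < n1) (hn1 : n ≤ n1)
    (hcase : (n1 = n ∧ Net = ∅ ∧ ∀ v ∈ R, o v ∈ bdryLabels G o C) ∨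
      (n1 = n + 1 ∧ Net ⊆ R ∧ R.Nonempty ∧ (∀ v ∈ R, o v = n) ∧
        (∀ x ∈ R, ∀ y ∈ R, ReachableIn G R x y) ∧
        (∀ i ∈ bdryLabels G o C, ∃ x ∈ R, ∃ p, G.Adj x p ∧ o p = i) ∧
        ∀ z, {t | t ∈ Net ∧ Within G w C z t ρ}.ncard ≤ m))
    (hnear : ∀ v ∈ R, ∃ t ∈ N ∪ Net, o t = o v ∧
      Within G w {x | x ∈ A ∪ R ∧ o x = o v} v t (η + δ * r))
    (hfar : ∀ z ∈ C, (z ∈ R → n ≤ o z) → ¬ NearBdry G w o C a δ z)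
    (aD : Set V → ℕ) (ND : Set V → Set V)
    (haD : ∀ D ∈ comps G (C \ R), ∀ i ∈ bdryLabels G o C, i ∉ bdryLabels G o D → aD D ≤ i)
    (hD : ∀ D ∈ comps G (C \ R),
      IsOutput G w r δ η ρ m D (A ∪ R) n1 (N ∪ Net) (aD D) o (ND D)) :
    IsOutput G w r δ η ρ m C A n N a o (Net ∪ {t | ∃ D ∈ comps G (C \ R), t ∈ ND D}) := by
  have hsubC : ∀ {D}, D ∈ comps G (C \ R) → D ⊆ C := fun hD => (comps_sub hD).trans Set.sdiff_subset
  have hncomp : ∀ {z}, z ∈ C → z ∉ R → ∃ D ∈ comps G (C \ R), z ∈ D := fun {z} hz hzR =>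
    ⟨_, mem_comps ⟨hz, hzR⟩, ReachableIn.refl (Set.mem_sdiff_of_mem hz hzR)⟩
  have hKD : ∀ {D}, D ∈ comps G (C \ R) → ∀ i ∈ bdryLabels G o D,
      i ∈ bdryLabels G o C ∨ (n1 = n + 1 ∧ i = n) := by
    rintro D hDc i ⟨u, hu, v, hv, huv, rfl⟩
    by_cases hvC : v ∈ C
    · have hvR : v ∈ R := by
        by_contra hvR
        exact hv (comps_closed hDc hu huv ⟨hvC, hvR⟩)
      rcases hcase with ⟨-, -, h1⟩ | ⟨h1, -, -, h2, -⟩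
      · exact Or.inl (h1 v hvR)
      · exact Or.inr ⟨h1, h2 v hvR⟩
    · exact Or.inl ⟨u, hsubC hDc hu, v, hvC, huv, rfl⟩
  have hlab : ∀ v ∈ C, n ≤ o v ∨ o v ∈ bdryLabels G o C := by
    intro v hv
    by_cases hvR : v ∈ R
    · rcases hcase with ⟨-, -, h1⟩ | ⟨-, -, -, h2, -⟩
      · exact Or.inr (h1 v hvR)
      · exact Or.inl (h2 v hvR).ge
    · obtain ⟨D, hDc, hvD⟩ := hncomp hv hvR
      rcases (hD D hDc).lab v hvD with h1 | h1
      · exact Or.inl (hn1.trans h1)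
      · rcases hKD hDc _ h1 with h2 | ⟨-, h2⟩
        · exact Or.inr h2
        · exact Or.inl h2.ge
  -- above level `n1`, everything happens inside a component
  have hset : ∀ {D}, D ∈ comps G (C \ R) → ∀ {b}, n1 ≤ b → ∀ {u}, u ∈ D → ∀ {v},
      G.Adj u v → v ∈ {x | x ∈ C ∧ b ≤ o x} → v ∈ D := by
    intro D hDc b hb u hu v huv hv
    refine comps_closed hDc hu huv ⟨hv.1, fun hvR => ?_⟩
    have := hlt v hvR
    have := hv.2
    omega
  have hsub : ∀ {D : Set V} {b : ℕ}, {x | x ∈ C ∧ b ≤ o x} ∩ D ⊆ {x | x ∈ D ∧ b ≤ o x} :=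
    fun {D b} x hx => ⟨hx.2, hx.1.2⟩
  have hal : ∀ {D}, D ∈ comps G (C \ R) → ∀ {z}, z ∈ D → ∀ {b}, n1 ≤ b → ∀ i,
      (AdjLabel G o C b z i ↔ AdjLabel G o D b z i) := by
    intro D hDc z hz b hb i
    constructor
    · rintro ⟨u, p, h1, h2, h3⟩
      exact ⟨u, p, (h1.of_closed hz fun x hx y hxy hy => hset hDc hb hx hxy hy).mono hsub, h2, h3⟩
    · rintro ⟨u, p, h1, h2, h3⟩
      exact ⟨u, p, h1.mono fun x hx => ⟨hsubC hDc hx.1, hx.2⟩, h2, h3⟩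
  have hnear' : ∀ v ∈ C, ∃ t ∈ N ∪ (Net ∪ {t | ∃ D ∈ comps G (C \ R), t ∈ ND D}), o t = o v ∧
      Within G w {x | x ∈ A ∪ C ∧ o x = o v} v t (η + δ * r) := by
    intro v hv
    by_cases hvR : v ∈ R
    · obtain ⟨t, ht, h1, h2⟩ := hnear v hvR
      refine ⟨t, ?_, h1, h2.mono ?_ le_rfl⟩
      · rcases ht with ht | ht
        exacts [Or.inl ht, Or.inr (Or.inl ht)]
      · rintro x ⟨hx | hx, hx'⟩
        exacts [⟨Or.inl hx, hx'⟩, ⟨Or.inr (hRC hx), hx'⟩]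
    · obtain ⟨D, hDc, hvD⟩ := hncomp hv hvR
      obtain ⟨t, ht, h1, h2⟩ := (hD D hDc).near v hvD
      refine ⟨t, ?_, h1, h2.mono ?_ le_rfl⟩
      · rcases ht with (ht | ht) | ht
        exacts [Or.inl ht, Or.inr (Or.inl ht), Or.inr (Or.inr ⟨D, hDc, ht⟩)]
      · rintro x ⟨(hx | hx) | hx, hx'⟩
        exacts [⟨Or.inl hx, hx'⟩, ⟨Or.inr (hRC hx), hx'⟩, ⟨Or.inr (hsubC hDc hx), hx'⟩]
  refine ⟨?_, hlab, ?_, ?_, ?_, ?_, ?_⟩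
  · rintro t (ht | ⟨D, hDc, ht⟩)
    · rcases hcase with ⟨-, h1, -⟩ | ⟨-, h1, -, h2, -⟩
      · simp [h1] at ht
      · exact ⟨hRC (h1 ht), (h2 t (h1 ht)).ge⟩
    · have := (hD D hDc).N_sub t ht
      exact ⟨hsubC hDc this.1, hn1.trans this.2⟩
  · exact hnear'
  · exact fun z hz hzn => hfar z hz fun _ => hzn
  · intro z hz b hb hbz
    by_cases hb1 : n1 ≤ b
    · have hzR : z ∉ R := fun hzR => by have := hlt z hzR; omega
      obtain ⟨D, hDc, hzD⟩ := hncomp hz hzR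
      simp only [hal hDc hzD hb1]
      exact (hD D hDc).few z hzD b hb1 hbz
    · refine lt_of_le_of_lt (Set.ncard_le_ncard ?_ ?_) hK
      · rintro i ⟨hi, u, p, h1, h2, h3⟩
        have hbn : b = n := by
          rcases hcase with ⟨h1, h2⟩ | ⟨h1, -⟩ <;> omega
        by_cases hp : p ∈ C
        · rcases hlab p hp with h4 | h4
          · omega
          · rwa [h3] at h4
        · exact ⟨u, h1.right_mem.1, p, hp, h2, h3⟩
      · exact (Set.finite_Iio n).subset fun i hi => h.bdryLabels_lt hi
  · intro z hz hzn i hi hiz hna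
    by_cases hz1 : n1 ≤ o z
    · have hzR : z ∉ R := fun hzR => by have := hlt z hzR; omega
      obtain ⟨D, hDc, hzD⟩ := hncomp hz hzR
      by_cases hi' : i ∈ bdryLabels G o D ∨ n1 ≤ i
      · rw [hal hDc hzD hz1] at hna
        obtain ⟨D0, h1, h2⟩ := (hD D hDc).buffer z hzD hz1 i hi' hiz hna
        exact ⟨D0, h1.trans (hsubC hDc), h2⟩
      · push Not at hi'
        obtain ⟨hi1, hi2⟩ := hi'
        have hiC : i ∈ bdryLabels G o C := by
          rcases hi with hi | hi
          · exact hi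
          · rcases hcase with ⟨h1, -⟩ | ⟨h1, -, ⟨y, hy⟩, h2, -⟩
            · omega
            · exfalso
              apply hi1
              have hyD : y ∉ D := fun hyD => (comps_sub hDc hyD).2 hy
              obtain ⟨u, v, -, hu, hv, hvC, huv⟩ := (h.conn z hz y (hRC hy)).exit hzD hyD
              have hvR : v ∈ R := by
                by_contra hvR
                exact hv (comps_closed hDc hu huv ⟨hvC, hvR⟩)
              exact ⟨u, hu, v, hv, huv, by rw [h2 v hvR]; omega⟩
        have hDi : ∀ v ∈ D, o v ≠ i := by
          rintro v hv rfl
          rcases (hD D hDc).lab v hv with h1 | h1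
          · omega
          · exact hi1 h1
        have hDadj : ∀ u ∈ D, ∀ v, G.Adj u v → o v ≠ i := by
          intro u hu v huv hvi
          by_cases hvD : v ∈ D
          · exact hDi v hvD hvi
          · exact hi1 ⟨u, hu, v, hvD, huv, hvi⟩
        refine ⟨D, hsubC hDc, hzD, hDi, hDadj, ?_⟩
        intro u hu v hv huv hiv α hα
        by_contra hle
        have hne := hDadj u hu v huv
        have := haD D hDc i hiC hi1
        exact (hD D hDc).far z hzD hz1 ⟨u, v, α, hα, hv, huv, by omega, not_lt.1 hle⟩
    · exfalso
      rcases hcase with ⟨h1, -⟩ | ⟨h1, hNet, -, h2, h3, h4, -⟩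
      · omega
      · have hoz : o z = n := by omega
        have hiC : i ∈ bdryLabels G o C := by
          rcases hi with hi | hi
          · exact hi
          · omega
        obtain ⟨t, ht, hto, hzt⟩ := hnear' z hz
        have htR : t ∈ R := by
          rcases ht with ht | ht | ⟨D, hDc, ht⟩
          · have := h.lt t (h.N_sub ht); omega
          · exact hNet ht
          · have := ((hD D hDc).N_sub t ht).2; omega
        obtain ⟨x, hx, p, hxp, hp⟩ := h4 i hiC
        refine hna ⟨x, p, ReachableIn.trans (hzt.reachableIn.mono ?_)
          ((h3 t htR x hx).mono ?_), hxp, hp⟩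
        · rintro v ⟨hv | hv, hv'⟩
          · have := h.lt v hv; omega
          · exact ⟨hv, hv'.ge⟩
        · intro v hv
          exact ⟨hRC hv, by rw [h2 v hv]; omega⟩
  · intro z b hb
    by_cases hb1 : n1 ≤ b
    · by_cases hz : z ∈ C ∧ b ≤ o z
      · have hzR : z ∉ R := fun hzR => by have := hlt z hzR; omega
        obtain ⟨D, hDc, hzD⟩ := hncomp hz.1 hzR
        refine le_trans (Set.ncard_le_ncard ?_ (Set.toFinite _)) ((hD D hDc).net z b hb1)
        rintro t ⟨ht, h1, h2⟩
        have h3 := h2.of_closed hzD fun x hx y hxy hy => hset hDc hb1 hx hxy hy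
        refine ⟨?_, h1, h3.mono hsub le_rfl⟩
        rcases ht with ht | ⟨D', hDc', ht⟩
        · exfalso
          rcases hcase with ⟨-, h5, -⟩ | ⟨-, h5, -⟩
          · simp [h5] at ht
          · have := hlt t (h5 ht); omega
        · have h4 := comps_eq hDc' ((hD D' hDc').N_sub t ht).1
          rw [← comps_eq hDc h3.right_mem.2] at h4
          rwa [h4] at ht
      · have : {t | t ∈ Net ∪ {t | ∃ D ∈ comps G (C \ R), t ∈ ND D} ∧ o t = b ∧
            Within G w {x | x ∈ C ∧ b ≤ o x} z t ρ} = ∅ := by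
          ext t
          simp only [Set.mem_ofPred_eq, Set.mem_empty_iff_false, iff_false]
          rintro ⟨-, -, h2⟩
          exact hz h2.left_mem
        rw [this]; simp
    · rcases hcase with ⟨h1, -⟩ | ⟨h1, -, -, h2, -, -, h3⟩
      · omega
      · refine le_trans (Set.ncard_le_ncard ?_ (Set.toFinite _)) (h3 z)
        rintro t ⟨ht | ⟨D, hDc, ht⟩, h4, h5⟩
        · exact ⟨ht, h5.mono (fun x hx => hx.1) le_rfl⟩
        · have := ((hD D hDc).N_sub t ht).2; omega

end Recursion

section Recursion

variable {V : Type*} {G : SimpleGraph V} {w : V → V → ℝ} {r m : ℕ} {δ η ρ : ℝ}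
  {C A D R : Set V} {n n1 : ℕ} {o o' : V → ℕ} {X : ℕ → Set V} {N N' Net : Set V} {a : ℕ}

/-- The components of `C \ R` satisfy the invariant again. -/
lemma IsState.child (h : IsState G w r δ η C A n o X N a) (hδ : 0 ≤ δ)
    (hlt : ∀ v ∈ R, o v < n1) (hn1 : n ≤ n1) (hNet : Net ⊆ R)
    (hcase : (n1 = n ∧ ∀ v ∈ R, o v ∈ bdryLabels G o C ∧ ∃ s ∈ X (o v),
        ReachableIn G (X (o v) ∪ {x | x ∈ R ∧ o x = o v}) v s) ∨
      (n1 = n + 1 ∧ (∀ v ∈ R, o v = n) ∧ (∀ x ∈ R, ∀ y ∈ R, ReachableIn G R x y) ∧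
        (∀ i ∈ bdryLabels G o C, ∃ x ∈ R, ∃ p ∈ X i, G.Adj x p)))
    (hrad : ∀ v ∈ R, ∃ t ∈ N ∪ Net, o t = o v ∧
      Within G w {x | x ∈ A ∪ R ∧ o x = o v} v t
        (η + δ * (r - (bdryLabels G o C ∩ Set.Iio (o v)).ncard)))
    (hD : D ∈ comps G (C \ R))
    {a' : ℕ} (ha' : (a' ∈ bdryLabels G o C ∧ a' ∉ bdryLabels G o D) ∨ n1 ≤ a') :
    IsState G w r δ η D (A ∪ R) n1 o (fun i => X i ∪ {v | v ∈ R ∧ o v = i}) (N ∪ Net) a' := by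
  have hDC : D ⊆ C := (comps_sub hD).trans Set.sdiff_subset
  have hb : ∀ u ∈ D, ∀ v, v ∉ D → G.Adj u v → v ∈ R ∨ v ∉ C := by
    intro u hu v hv huv
    by_contra hcon
    push Not at hcon
    exact hv (comps_closed hD hu huv ⟨hcon.2, hcon.1⟩)
  have hKD : ∀ i ∈ bdryLabels G o D, i ∈ bdryLabels G o C ∨ (n1 = n + 1 ∧ i = n) := by
    rintro i ⟨u, hu, v, hv, huv, rfl⟩
    rcases hb u hu v hv huv with hvR | hvC
    · rcases hcase with ⟨-, h1⟩ | ⟨h1, h2, -⟩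
      · exact Or.inl (h1 v hvR).1
      · exact Or.inr ⟨h1, h2 v hvR⟩
    · exact Or.inl ⟨u, hDC hu, v, hvC, huv, rfl⟩
  have hltA : ∀ v ∈ A ∪ R, o v < n1 := by
    rintro v (hv | hv)
    · exact (h.lt v hv).trans_le hn1
    · exact hlt v hv
  refine ⟨comps_nonempty hD, fun x hx y hy => comps_conn hD hx hy, ?_, ?_, hltA, ?_, ?_, ?_, ?_, ?_⟩
  · intro u hu v hv huv
    rcases hb u hu v hv huv with hvR | hvC
    · exact Or.inr ⟨hvR, rfl⟩
    · exact Or.inl (h.bdry u (hDC hu) v hvC huv)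
  · rintro v (hv | hv) hvD
    · exact h.disj v hv (hDC hvD)
    · exact (comps_sub hD hvD).2 hv
  · rintro i v (hv | hv)
    · exact ⟨Or.inl (h.X_sub i v hv).1, (h.X_sub i v hv).2⟩
    · exact ⟨Or.inr hv.1, hv.2⟩
  · intro i hi
    rcases hKD i hi with hiC | ⟨h1, rfl⟩
    · have key : ∀ x ∈ X i ∪ {v | v ∈ R ∧ o v = i}, ∃ s ∈ X i,
          ReachableIn G (X i ∪ {v | v ∈ R ∧ o v = i}) x s := by
        rintro x (hx | ⟨hx, rfl⟩)
        · exact ⟨x, hx, ReachableIn.refl (Or.inl hx)⟩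
        · rcases hcase with ⟨-, h2⟩ | ⟨-, h2, -⟩
          · exact (h2 x hx).2
          · have := h.bdryLabels_lt hiC
            have := h2 x hx
            omega
      intro x hx y hy
      obtain ⟨s, hs, hxs⟩ := key x hx
      obtain ⟨t, ht, hyt⟩ := key y hy
      exact (hxs.trans ((h.X_conn i hiC s hs t ht).mono Set.subset_union_left)).trans hyt.symm
    · rcases hcase with ⟨h0, -⟩ | ⟨-, h2, h3, -⟩
      · omega
      · have : ∀ x ∈ X i ∪ {v | v ∈ R ∧ o v = i}, x ∈ R := by
          rintro x (hx | hx)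
          · have h4 := h.X_sub i x hx
            have := h.lt x h4.1
            omega
          · exact hx.1
        intro x hx y hy
        exact (h3 x (this x hx) y (this y hy)).mono fun v hv => Or.inr ⟨hv, h2 v hv⟩
  · have key : ∀ j ∈ bdryLabels G o C, n1 = n + 1 → ∃ x ∈ R, o x = n ∧ ∃ y ∈ X j, G.Adj x y := by
      intro j hj hn
      rcases hcase with ⟨h0, -⟩ | ⟨-, h2, -, h4⟩
      · omega
      · obtain ⟨x, hx, p, hp, hxp⟩ := h4 j hj
        exact ⟨x, hx, h2 x hx, p, hp, hxp⟩
    intro i hi j hj hij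
    rcases hKD i hi with hiC | ⟨h1, rfl⟩
    · rcases hKD j hj with hjC | ⟨h1, rfl⟩
      · obtain ⟨x, hx, y, hy, hxy⟩ := h.X_adj i hiC j hjC hij
        exact ⟨x, Or.inl hx, y, Or.inl hy, hxy⟩
      · obtain ⟨x, hx, hxn, y, hy, hxy⟩ := key i hiC h1
        exact ⟨y, Or.inl hy, x, Or.inr ⟨hx, hxn⟩, hxy.symm⟩
    · rcases hKD j hj with hjC | ⟨-, rfl⟩
      · obtain ⟨x, hx, hxn, y, hy, hxy⟩ := key j hjC h1
        exact ⟨x, Or.inr ⟨hx, hxn⟩, y, Or.inl hy, hxy⟩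
      · exact absurd rfl hij
  · exact Set.union_subset_union h.N_sub hNet
  · intro u hu v hv huv
    have hvlt : o v < n1 := by
      rcases hb u hu v hv huv with hvR | hvC
      · exact hlt v hvR
      · exact hltA v (Or.inl (h.bdry_mem (hDC hu) hvC huv))
    have hfin : (bdryLabels G o C ∩ Set.Iio (o v)).Finite :=
      (Set.finite_Iio (o v)).subset Set.inter_subset_right
    have hsub : bdryLabels G o D ∩ Set.Iio (o v) ⊆ bdryLabels G o C ∩ Set.Iio (o v) := by
      rintro i ⟨hi, hiv⟩
      refine ⟨?_, hiv⟩
      rcases hKD i hi with hiC | ⟨h1, rfl⟩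
      · exact hiC
      · simp only [Set.mem_Iio] at hiv
        omega
    have hrank : ((bdryLabels G o D ∩ Set.Iio (o v)).ncard : ℝ) + (if a' < o v then 1 else 0) ≤
        (bdryLabels G o C ∩ Set.Iio (o v)).ncard := by
      split_ifs with hav
      · rcases ha' with ⟨h1, h2⟩ | h1
        · have : bdryLabels G o D ∩ Set.Iio (o v) ⊂ bdryLabels G o C ∩ Set.Iio (o v) :=
            (Set.ssubset_iff_of_subset hsub).2 ⟨a', ⟨h1, hav⟩, fun h3 => h2 h3.1⟩
          have := Set.ncard_lt_ncard this hfin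
          exact_mod_cast this
        · omega
      · have := Set.ncard_le_ncard hsub hfin
        simpa using this
    have hbig : ∃ t ∈ N ∪ Net, o t = o v ∧ Within G w {x | x ∈ A ∪ R ∧ o x = o v} v t
        (η + δ * (r - (bdryLabels G o C ∩ Set.Iio (o v)).ncard)) := by
      rcases hb u hu v hv huv with hvR | hvC
      · exact hrad v hvR
      · obtain ⟨t, ht, h1, h2⟩ := h.radius u (hDC hu) v hvC huv
        refine ⟨t, Or.inl ht, h1, h2.mono ?_ ?_⟩
        · rintro x ⟨hx, hx'⟩
          exact ⟨Or.inl hx, hx'⟩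
        · have : (0 : ℝ) ≤ if a < o v then 1 else 0 := by split_ifs <;> norm_num
          exact add_le_add le_rfl (mul_le_mul_of_nonneg_left (by linarith) hδ)
    obtain ⟨t, ht, h1, h2⟩ := hbig
    refine ⟨t, ht, h1, h2.mono le_rfl ?_⟩
    exact add_le_add le_rfl (mul_le_mul_of_nonneg_left (by linarith) hδ)

/-- Few boundary labels, by minor-freeness. -/
lemma IsState.ncard_bdryLabels_lt (h : IsState G w r δ η C A n o X N a)
    (hminor : ¬ HasCliqueMinor G (r + 1)) : (bdryLabels G o C).ncard < r := by
  by_contra hcon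
  apply hminor
  have hfin : (bdryLabels G o C).Finite :=
    (Set.finite_Iio n).subset fun i hi => h.bdryLabels_lt hi
  have hcard : r ≤ hfin.toFinset.card := by
    rw [← Set.ncard_eq_toFinset_card _ hfin]; omega
  let e : Fin r → ℕ := fun i => hfin.toFinset.orderEmbOfCardLe hcard i
  have he : ∀ i, e i ∈ bdryLabels G o C := fun i =>
    hfin.mem_toFinset.1 (Finset.orderEmbOfCardLe_mem _ hcard i)
  have heinj : ∀ i j, i ≠ j → e i ≠ e j := fun i j hij h' =>
    hij ((hfin.toFinset.orderEmbOfCardLe hcard).injective h')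
  have hconn : ∀ s : Set V, s.Nonempty → (∀ x ∈ s, ∀ y ∈ s, ReachableIn G s x y) →
      (G.induce s).Connected := by
    intro s hs hc
    have := hs.to_subtype
    refine ⟨?_⟩
    rintro ⟨x, hx⟩ ⟨y, hy⟩
    obtain ⟨p, hp⟩ := hc x hx y hy
    exact ⟨p.induce s hp⟩
  have htouch : ∀ i ∈ bdryLabels G o C, ∃ u ∈ C, ∃ v ∈ X i, G.Adj u v := by
    rintro i ⟨u, hu, v, hv, huv, rfl⟩
    exact ⟨u, hu, v, h.bdry u hu v hv huv, huv⟩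
  refine ⟨Fin.cons C fun i => X (e i), ?_, ?_, ?_, ?_⟩
  · refine Fin.cases ?_ ?_
    · simpa using h.nonempty
    · intro i
      obtain ⟨u, -, v, hv, -⟩ := htouch _ (he i)
      simpa using ⟨v, hv⟩
  · refine Fin.cases ?_ ?_
    · exact hconn C h.nonempty h.conn
    · intro i
      obtain ⟨u, -, v, hv, -⟩ := htouch _ (he i)
      exact hconn (X (e i)) ⟨v, hv⟩ (h.X_conn _ (he i))
  · have hd : ∀ i, Disjoint C (X i) := fun i =>
      Set.disjoint_left.2 fun v hv hv' => h.disj v (h.X_sub i v hv').1 hv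
    refine Fin.cases (Fin.cases ?_ ?_) fun i => Fin.cases ?_ ?_
    · simp
    · intro j _; simpa using hd (e j)
    · intro _; simpa using (hd (e i)).symm
    · intro j hij
      simp only [Fin.cons_succ]
      refine Set.disjoint_left.2 fun v hv hv' => heinj i j (by simpa using hij) ?_
      rw [← (h.X_sub _ v hv).2, ← (h.X_sub _ v hv').2]
  · refine Fin.cases (Fin.cases ?_ ?_) fun i => Fin.cases ?_ ?_
    · simp
    · intro j _; simpa using htouch _ (he j)
    · intro _
      obtain ⟨u, hu, v, hv, huv⟩ := htouch _ (he i)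
      simpa using ⟨v, hv, u, hu, huv.symm⟩
    · intro j hij
      simpa using h.X_adj _ (he i) _ (he j) (heinj i j (by simpa using hij))

end Recursion

section Recursion

variable {V : Type*} {G : SimpleGraph V} {w : V → V → ℝ} {r m : ℕ} {δ η ρ : ℝ}
  {C A D R : Set V} {n n1 : ℕ} {o o' : V → ℕ} {X : ℕ → Set V} {N N' Net : Set V} {a : ℕ}

/-- Each vertex close to the boundary can be given the label of its nearest boundary vertex, in
such a way that the shortest walk to that vertex carries a single label. -/
lemma exists_growth [Finite V] (hw : ∀ u v, G.Adj u v → 0 < w u v) (o : V → ℕ) (C : Set V)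
    (a : ℕ) (δ : ℝ) :
    ∃ o' : V → ℕ, (∀ v, ¬ (v ∈ C ∧ NearBdry G w o C a δ v) → o' v = o v) ∧
      ∀ v ∈ C, NearBdry G w o C a δ v → ∃ u ∈ C, ∃ s, s ∉ C ∧ G.Adj u s ∧ a < o s ∧ o s = o' v ∧
        Within G w ({x | (x ∈ C ∧ NearBdry G w o C a δ x) ∧ o' x = o' v} ∪ {s}) v s δ := by
  classical
  let Reach : V → ℕ → ℝ → Prop := fun v j c =>
    ∃ u s α, Within G w C v u α ∧ s ∉ C ∧ G.Adj u s ∧ a < o s ∧ o s = j ∧ α + w u s ≤ c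
  have step : ∀ {v x j c c'}, Within G w C v x c → Reach x j c' → Reach v j (c + c') := by
    rintro v x j c c' h1 ⟨u, s, α, h2, h3, h4, h5, h6, h7⟩
    exact ⟨u, s, c + α, h1.trans h2, h3, h4, h5, h6, by linarith⟩
  have hmin : ∀ v, ∃ g j, NearBdry G w o C a δ v → Reach v j g ∧ g ≤ δ ∧
      (∀ j' c', Reach v j' c' → g ≤ c') ∧ ∀ j', Reach v j' g → j ≤ j' := by
    intro v
    by_cases hv : NearBdry G w o C a δ v
    · have hd : ∀ u, ∃ d, ReachableIn G C v u → IsLeast {ρ | Within G w C v u ρ} d := by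
        intro u
        by_cases hu : ReachableIn G C v u
        · obtain ⟨d, hd⟩ := hu.isLeast hw
          exact ⟨d, fun _ => hd⟩
        · exact ⟨0, fun h => absurd h hu⟩
      choose d hd using hd
      let S : Set (V × V) := {q | ReachableIn G C v q.1 ∧ q.2 ∉ C ∧ G.Adj q.1 q.2 ∧ a < o q.2}
      obtain ⟨u0, s0, α0, h1, h2, h3, h4, h5⟩ := hv
      obtain ⟨⟨u, s⟩, ⟨hu1, hu2, hu3, hu4⟩, hmin⟩ := Set.exists_min_image S
        (fun q => d q.1 + w q.1 q.2) (Set.toFinite _) ⟨(u0, s0), h1.reachableIn, h2, h3, h4⟩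
      have hg : ∀ j' c', Reach v j' c' → d u + w u s ≤ c' := by
        rintro j' c' ⟨u', s', α', k1, k2, k3, k4, k5, k6⟩
        have := hmin (u', s') ⟨k1.reachableIn, k2, k3, k4⟩
        have := (hd u' k1.reachableIn).2 k1
        simp only at *
        linarith
      have hR : ∃ j, Reach v j (d u + w u s) :=
        ⟨o s, u, s, d u, (hd u hu1).1, hu2, hu3, hu4, rfl, le_rfl⟩
      exact ⟨d u + w u s, Nat.find hR, fun _ => ⟨Nat.find_spec hR,
        (hg (o s0) _ ⟨u0, s0, α0, h1, h2, h3, h4, rfl, le_rfl⟩).trans h5, hg,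
        fun j' hj' => Nat.find_min' hR hj'⟩⟩
    · exact ⟨0, 0, fun h => absurd h hv⟩
  choose g j hgj using hmin
  obtain ⟨o', ho1, ho2⟩ : ∃ o' : V → ℕ, (∀ v, ¬ (v ∈ C ∧ NearBdry G w o C a δ v) → o' v = o v) ∧
      ∀ v, (v ∈ C ∧ NearBdry G w o C a δ v) → o' v = j v :=
    ⟨fun v => if v ∈ C ∧ NearBdry G w o C a δ v then j v else o v, fun v hv => if_neg hv,
      fun v hv => if_pos hv⟩
  refine ⟨o', ho1, ?_⟩
  · intro v hvC hv
    obtain ⟨⟨u, s, α, ⟨p, hp, hpα⟩, h2, h3, h4, h5, h6⟩, hle, hg, hj⟩ := hgj v hv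
    have key : ∀ x ∈ p.support, (x ∈ C ∧ NearBdry G w o C a δ x) ∧ j x = j v := by
      intro x hx
      obtain ⟨p1, p2, rfl⟩ := walk_split p hx
      rw [walkWeight_append] at hpα
      have hs1 : Within G w C v x (walkWeight w p1) :=
        ⟨p1, fun y hy => hp y ((SimpleGraph.Walk.mem_support_append_iff _ _).2 (Or.inl hy)), le_rfl⟩
      have hs2 : Within G w C x u (walkWeight w p2) :=
        ⟨p2, fun y hy => hp y ((SimpleGraph.Walk.mem_support_append_iff _ _).2 (Or.inr hy)), le_rfl⟩
      have hRx : Reach x (j v) (g v - walkWeight w p1) :=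
        ⟨u, s, _, hs2, h2, h3, h4, h5, by linarith⟩
      have hnb : NearBdry G w o C a δ x :=
        ⟨u, s, _, hs2, h2, h3, h4, by linarith [walkWeight_nonneg hw p1]⟩
      obtain ⟨k1, k2, k3, k4⟩ := hgj x hnb
      have e1 := hg _ _ (step hs1 k1)
      have e2 := k3 _ _ hRx
      have e3 : g x = g v - walkWeight w p1 := by linarith
      refine ⟨⟨hs1.right_mem, hnb⟩, le_antisymm (k4 _ (e3 ▸ hRx)) (hj _ ?_)⟩
      have := step hs1 k1
      rwa [e3, add_sub_cancel] at this
    have hu := (key u p.end_mem_support).1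
    refine ⟨u, hu.1, s, h2, h3, h4, ?_, ?_⟩
    · rw [ho2 v ⟨hvC, hv⟩, h5]
    · have hp' : Within G w ({x | (x ∈ C ∧ NearBdry G w o C a δ x) ∧ o' x = o' v} ∪ {s}) v u α := by
        refine ⟨p, fun x hx => Or.inl ⟨(key x hx).1, ?_⟩, hpα⟩
        rw [ho2 x (key x hx).1, ho2 v ⟨hvC, hv⟩, (key x hx).2]
      exact (hp'.trans (Within.edge h3 hp'.right_mem (Or.inr rfl))).mono le_rfl (by linarith)

/-- A shortest walk in `C` together with a sparse net on it. -/
lemma exists_path_net [Finite V] (hw : ∀ u v, G.Adj u v → 0 < w u v)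
    (hws : ∀ u v, w u v = w v u) (hη : 0 < η) {k : ℕ} (hk : 2 * ρ ≤ k * η)
    {x u : V} (hxu : ReachableIn G C x u) :
    ∃ P Net : Set V, P ⊆ C ∧ x ∈ P ∧ u ∈ P ∧ (∀ v ∈ P, ReachableIn G P x v) ∧ Net ⊆ P ∧
      (∀ v ∈ P, ∃ t ∈ Net, Within G w P v t η) ∧
      ∀ z, {t | t ∈ Net ∧ Within G w C z t ρ}.ncard ≤ k + 1 := by
  classical
  obtain ⟨p, hp, hmin⟩ := exists_shortest_walk hw hxu
  let P : Set V := {v | v ∈ p.support}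
  have hd : ∀ v, ∃ d, v ∈ P → ∀ (p1 : G.Walk x v) (p2 : G.Walk v u), p = p1.append p2 →
      walkWeight w p1 = d := by
    intro v
    by_cases hv : v ∈ P
    · obtain ⟨q1, q2, hq⟩ := walk_split p hv
      have aux : ∀ (p1 q1 : G.Walk x v) (p2 q2 : G.Walk v u), p = p1.append p2 → p = q1.append q2 →
          walkWeight w p1 ≤ walkWeight w q1 := by
        intro p1 q1 p2 q2 h1 h2
        have := hmin (q1.append p2) (by
          intro y hy
          rcases (SimpleGraph.Walk.mem_support_append_iff _ _).1 hy with hy | hy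
          · exact hp y (h2 ▸ (SimpleGraph.Walk.mem_support_append_iff _ _).2 (Or.inl hy))
          · exact hp y (h1 ▸ (SimpleGraph.Walk.mem_support_append_iff _ _).2 (Or.inr hy)))
        rw [h1, walkWeight_append, walkWeight_append] at this
        linarith
      exact ⟨walkWeight w q1, fun _ p1 p2 h1 => le_antisymm (aux _ _ _ _ h1 hq) (aux _ _ _ _ hq h1)⟩
    · exact ⟨0, fun h => absurd h hv⟩
  choose d hd using hd
  have hd0 : ∀ v ∈ P, 0 ≤ d v := by
    intro v hv
    obtain ⟨q1, q2, hq⟩ := walk_split p hv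
    rw [← hd v hv q1 q2 hq]
    exact walkWeight_nonneg hw _
  -- points of the walk are as close along the walk as their positions say
  have hdist : ∀ v ∈ P, ∀ v' ∈ P, Within G w P v v' |d v - d v'| := by
    have aux : ∀ v v' (q1 : G.Walk x v) (q2 : G.Walk v v') (q3 : G.Walk v' u),
        p = (q1.append q2).append q3 → Within G w P v v' |d v - d v'| := by
      intro v v' q1 q2 q3 hq
      have hs : ∀ y, y ∈ q2.support → y ∈ P := by
        intro y hy
        change y ∈ p.support
        rw [hq]
        exact (SimpleGraph.Walk.mem_support_append_iff _ _).2 (Or.inl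
          ((SimpleGraph.Walk.mem_support_append_iff _ _).2 (Or.inr hy)))
      have e1 := hd v (hs _ q2.start_mem_support) q1 (q2.append q3)
        (by rw [hq, SimpleGraph.Walk.append_assoc])
      have e2 := hd v' (hs _ q2.end_mem_support) _ _ hq
      rw [walkWeight_append] at e2
      exact ⟨q2, hs, by rw [abs_sub_comm]; exact le_trans (by linarith) (le_abs_self _)⟩
    intro v hv v' hv'
    obtain ⟨q1, q2, hq⟩ := walk_split p hv
    have hv'2 : v' ∈ (q1.append q2).support := hq ▸ hv'
    rcases (SimpleGraph.Walk.mem_support_append_iff _ _).1 hv'2 with h1 | h1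
    · obtain ⟨q3, q4, h2⟩ := walk_split q1 h1
      have := aux v' v q3 q4 q2 (by rw [hq, h2])
      rw [abs_sub_comm]
      exact this.symm hws
    · obtain ⟨q3, q4, h2⟩ := walk_split q2 h1
      exact aux v v' q1 q3 q4 (by rw [hq, h2, SimpleGraph.Walk.append_assoc])
  have hshort : ∀ v ∈ P, ∀ c, Within G w C x v c → d v ≤ c := by
    rintro v hv c ⟨q, hq, hqc⟩
    obtain ⟨q1, q2, hpq⟩ := walk_split p hv
    have := hmin (q.append q2) (by
      intro y hy
      rcases (SimpleGraph.Walk.mem_support_append_iff _ _).1 hy with hy | hy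
      · exact hq y hy
      · exact hp y (hpq ▸ (SimpleGraph.Walk.mem_support_append_iff _ _).2 (Or.inr hy)))
    rw [hpq, walkWeight_append, walkWeight_append, hd v hv q1 q2 hpq] at this
    linarith
  have hreach : ∀ v ∈ P, Within G w P x v (d v) := by
    intro v hv
    have h0 : d x = 0 := (hd x p.start_mem_support .nil p (by simp)).symm.trans (by simp)
    have := hdist x p.start_mem_support v hv
    rwa [h0, zero_sub, abs_neg, abs_of_nonneg (hd0 v hv)] at this
  let β : V → ℕ := fun v => ⌊d v / η⌋₊
  let rep : ℕ → V := fun i => if h : ∃ v ∈ P, β v = i then h.choose else x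
  have hrep : ∀ v ∈ P, rep (β v) ∈ P ∧ β (rep (β v)) = β v := by
    intro v hv
    have h : ∃ v' ∈ P, β v' = β v := ⟨v, hv, rfl⟩
    simp only [rep, dif_pos h]
    exact h.choose_spec
  have hPC : P ⊆ C := fun v hv => hp v hv
  refine ⟨P, {t | ∃ v ∈ P, t = rep (β v)}, hPC, p.start_mem_support,
    p.end_mem_support, fun v hv => (hreach v hv).reachableIn, ?_, ?_, ?_⟩
  · rintro t ⟨v, hv, rfl⟩
    exact (hrep v hv).1
  · intro v hv
    obtain ⟨h1, h2⟩ := hrep v hv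
    refine ⟨_, ⟨v, hv, rfl⟩, (hdist v hv _ h1).mono le_rfl ?_⟩
    have a1 := Nat.floor_le (div_nonneg (hd0 v hv) hη.le)
    have a2 := Nat.lt_floor_add_one (d v / η)
    have b1 := Nat.floor_le (div_nonneg (hd0 _ h1) hη.le)
    have b2 := Nat.lt_floor_add_one (d (rep (β v)) / η)
    simp only [β] at h2
    rw [h2] at b1 b2
    rw [le_div_iff₀ hη] at a1 b1
    rw [div_lt_iff₀ hη] at a2 b2
    rw [abs_le]
    constructor <;> linarith
  · intro z
    set S := {t | t ∈ {t | ∃ v ∈ P, t = rep (β v)} ∧ Within G w C z t ρ} with hS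
    rcases S.eq_empty_or_nonempty with hE | hne
    · rw [hE]; simp
    have hSP : ∀ t ∈ S, t ∈ P := by
      rintro t ⟨⟨v, hv, rfl⟩, -⟩
      exact (hrep v hv).1
    obtain ⟨t0, ht0, ht0min⟩ := Set.exists_min_image S d (Set.toFinite _) hne
    have hmaps : ∀ t ∈ S, β t ∈ ((Finset.Icc (β t0) (β t0 + k) : Finset ℕ) : Set ℕ) := by
      intro t ht
      have h1 : d t ≤ d t0 + (ρ + ρ) :=
        hshort t (hSP t ht) _ (((hreach t0 (hSP t0 ht0)).mono hPC le_rfl).trans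
          ((ht0.2.symm hws).trans ht.2))
      rw [Finset.coe_Icc, Set.mem_Icc]
      constructor
      · exact Nat.floor_mono (div_le_div_of_nonneg_right (ht0min t ht) hη.le)
      · rw [← Nat.floor_add_natCast (div_nonneg (hd0 _ (hSP t0 ht0)) hη.le)]
        refine Nat.floor_mono ?_
        rw [div_le_iff₀ hη, add_mul, div_mul_cancel₀ _ hη.ne']
        linarith
    have hinj : Set.InjOn β S := by
      rintro t ⟨⟨v, hv, rfl⟩, -⟩ t' ⟨⟨v', hv', rfl⟩, -⟩ h
      rw [(hrep v hv).2, (hrep v' hv').2] at h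
      rw [h]
    refine (Set.ncard_le_ncard_of_injOn β hmaps hinj (Finset.finite_toSet _)).trans ?_
    rw [Set.ncard_coe_finset, Nat.card_Icc]
    omega

/-- A connected set containing prescribed vertices, with a sparse net. -/
lemma exists_tree_net [Finite V] (hw : ∀ u v, G.Adj u v → 0 < w u v)
    (hws : ∀ u v, w u v = w v u) (hη : 0 < η) {k : ℕ} (hk : 2 * ρ ≤ k * η)
    (hC : ∀ x ∈ C, ∀ y ∈ C, ReachableIn G C x y) (U : Finset V) (hU : ∀ u ∈ U, u ∈ C)
    (hUne : U.Nonempty) :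
    ∃ T Net : Set V, T ⊆ C ∧ (∀ u ∈ U, u ∈ T) ∧ (∀ x ∈ T, ∀ y ∈ T, ReachableIn G T x y) ∧
      Net ⊆ T ∧ (∀ v ∈ T, ∃ t ∈ Net, Within G w T v t η) ∧
      ∀ z, {t | t ∈ Net ∧ Within G w C z t ρ}.ncard ≤ U.card * (k + 1) := by
  obtain ⟨x, hx⟩ := hUne
  have hp : ∀ u : U, _ := fun u =>
    exists_path_net hw hws hη hk (hC x (hU x hx) u (hU u u.2))
  choose P Net h1 h2 h3 h4 h5 h6 h7 using hp
  have hmem : ∀ {v}, v ∈ (⋃ u, P u) → ReachableIn G (⋃ u, P u) x v := by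
    intro v hv
    obtain ⟨u, hu⟩ := Set.mem_iUnion.1 hv
    exact (h4 u v hu).mono (Set.subset_iUnion P u)
  refine ⟨⋃ u, P u, ⋃ u, Net u, Set.iUnion_subset h1, fun u hu => Set.mem_iUnion.2 ⟨⟨u, hu⟩, h3 _⟩,
    fun y hy z hz => (hmem hy).symm.trans (hmem hz), Set.iUnion_mono h5, ?_, ?_⟩
  · intro v hv
    obtain ⟨u, hu⟩ := Set.mem_iUnion.1 hv
    obtain ⟨t, ht, hvt⟩ := h6 u v hu
    exact ⟨t, Set.mem_iUnion.2 ⟨u, ht⟩, hvt.mono (Set.subset_iUnion P u) le_rfl⟩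
  · intro z
    have : {t | t ∈ (⋃ u, Net u) ∧ Within G w C z t ρ} =
        ⋃ u ∈ U.attach, {t | t ∈ Net u ∧ Within G w C z t ρ} := by
      ext t
      simp
    rw [this]
    refine (Finset.set_ncard_biUnion_le _ _).trans ((Finset.sum_le_sum fun u _ => h7 u z).trans ?_)
    simp

end Recursion

section Recursion

variable {V : Type*} {G : SimpleGraph V} {w : V → V → ℝ} {r m : ℕ} {δ η ρ : ℝ}
  {C A D R : Set V} {n n1 : ℕ} {o o' : V → ℕ} {X : ℕ → Set V} {N N' Net : Set V} {a : ℕ}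

/-- Once the vertices of `R` are labelled, outputs for the components of `C \ R` yield one
for `C`. -/
lemma IsState.extend [Finite V] (h : IsState G w r δ η C A n o X N a) (hδ : 0 ≤ δ)
    (hminor : ¬ HasCliqueMinor G (r + 1))
    (hRC : R ⊆ C) (hlt : ∀ v ∈ R, o v < n1) (hn1 : n ≤ n1) (hNet : Net ⊆ R)
    (hcase : (n1 = n ∧ Net = ∅ ∧ ∀ v ∈ R, o v ∈ bdryLabels G o C ∧ ∃ s ∈ X (o v),
        ReachableIn G (X (o v) ∪ {x | x ∈ R ∧ o x = o v}) v s) ∨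
      (n1 = n + 1 ∧ R.Nonempty ∧ (∀ v ∈ R, o v = n) ∧
        (∀ x ∈ R, ∀ y ∈ R, ReachableIn G R x y) ∧
        (∀ i ∈ bdryLabels G o C, ∃ x ∈ R, ∃ p ∈ X i, G.Adj x p) ∧
        ∀ z, {t | t ∈ Net ∧ Within G w C z t ρ}.ncard ≤ m))
    (hrad : ∀ v ∈ R, ∃ t ∈ N ∪ Net, o t = o v ∧
      Within G w {x | x ∈ A ∪ R ∧ o x = o v} v t
        (η + δ * (r - (bdryLabels G o C ∩ Set.Iio (o v)).ncard)))
    (hfar : ∀ z ∈ C, (z ∈ R → n ≤ o z) → ¬ NearBdry G w o C a δ z)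
    (ih : ∀ D ∈ comps G (C \ R), ∀ A n o X N a, IsState G w r δ η D A n o X N a →
      ∃ o' N', (∀ v, v ∉ D → o' v = o v) ∧ IsOutput G w r δ η ρ m D A n N a o' N') :
    ∃ o' N', (∀ v, v ∉ C → o' v = o v) ∧ IsOutput G w r δ η ρ m C A n N a o' N' := by
  classical
  have haD : ∀ D, ∃ a', (∀ i ∈ bdryLabels G o C, i ∉ bdryLabels G o D → a' ≤ i) ∧
      ((a' ∈ bdryLabels G o C ∧ a' ∉ bdryLabels G o D) ∨ n1 ≤ a') := by
    intro D
    by_cases hex : ∃ i, i ∈ bdryLabels G o C ∧ i ∉ bdryLabels G o D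
    · exact ⟨Nat.find hex, fun i h1 h2 => Nat.find_min' hex ⟨h1, h2⟩, Or.inl (Nat.find_spec hex)⟩
    · exact ⟨n1, fun i h1 h2 => absurd ⟨i, h1, h2⟩ hex, Or.inr le_rfl⟩
  choose aD haD1 haD2 using haD
  have hchild : ∀ D ∈ comps G (C \ R), IsState G w r δ η D (A ∪ R) n1 o
      (fun i => X i ∪ {v | v ∈ R ∧ o v = i}) (N ∪ Net) (aD D) := by
    intro D hD
    refine h.child hδ hlt hn1 hNet ?_ hrad hD (haD2 D)
    rcases hcase with ⟨h1, -, h2⟩ | ⟨h1, -, h2, h3, h4, -⟩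
    · exact Or.inl ⟨h1, h2⟩
    · exact Or.inr ⟨h1, h2, h3, h4⟩
  have hout : ∀ D, ∃ o' N', D ∈ comps G (C \ R) → (∀ v, v ∉ D → o' v = o v) ∧
      IsOutput G w r δ η ρ m D (A ∪ R) n1 (N ∪ Net) (aD D) o' N' := by
    intro D
    by_cases hD : D ∈ comps G (C \ R)
    · obtain ⟨o', N', h1⟩ := ih D hD _ _ _ _ _ _ (hchild D hD)
      exact ⟨o', N', fun _ => h1⟩
    · exact ⟨o, ∅, fun h => absurd h hD⟩
  choose F ND hF using hout
  obtain ⟨o', ho1, ho2⟩ : ∃ o' : V → ℕ, (∀ v, v ∉ C \ R → o' v = o v) ∧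
      ∀ D ∈ comps G (C \ R), ∀ v ∈ D, o' v = F D v := by
    refine ⟨fun v => if v ∈ C \ R then F {u | ReachableIn G (C \ R) v u} v else o v,
      fun v hv => if_neg hv, fun D hD v hv => ?_⟩
    simp only [if_pos (comps_sub hD hv)]
    rw [← comps_eq hD hv]
  have hoA : ∀ v ∈ A, o' v = o v := fun v hv => ho1 v fun hv' => h.disj v hv hv'.1
  have hoR : ∀ v ∈ R, o' v = o v := fun v hv => ho1 v fun hv' => hv'.2 hv
  have hK : bdryLabels G o' C = bdryLabels G o C :=
    bdryLabels_congr (fun u hu v hv huv => h.bdry_mem hu hv huv) hoA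
  have hKD : ∀ D ∈ comps G (C \ R), bdryLabels G o' D = bdryLabels G o D := fun D hD =>
    bdryLabels_congr (fun u hu v hv huv => (hchild D hD).bdry_mem hu hv huv)
      fun v hv => hv.elim (hoA v) (hoR v)
  refine ⟨o', _, fun v hv => ho1 v fun hv' => hv hv'.1, (h.congr hoA).glue
    (n1 := n1) (R := R) (Net := Net) ?_ hRC ?_ hn1 ?_ ?_ ?_ aD ND ?_ ?_⟩
  · rw [hK]; exact h.ncard_bdryLabels_lt hminor
  · intro v hv
    rw [hoR v hv]; exact hlt v hv
  · rw [hK]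
    rcases hcase with ⟨h1, h1', h2⟩ | ⟨h1, h1', h2, h3, h4, h5⟩
    · exact Or.inl ⟨h1, h1', fun v hv => by rw [hoR v hv]; exact (h2 v hv).1⟩
    · refine Or.inr ⟨h1, hNet, h1', fun v hv => by rw [hoR v hv]; exact h2 v hv, h3, ?_, h5⟩
      intro i hi
      obtain ⟨x, hx, p, hp, hxp⟩ := h4 i hi
      have := h.X_sub i p hp
      exact ⟨x, hx, p, hxp, by rw [hoA p this.1, this.2]⟩
  · intro v hv
    obtain ⟨t, ht, h1, h2⟩ := hrad v hv
    have hto : o' t = o t := by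
      rcases ht with ht | ht
      exacts [hoA t (h.N_sub ht), hoR t (hNet ht)]
    refine ⟨t, ht, by rw [hto, hoR v hv, h1], h2.mono ?_ ?_⟩
    · rintro x ⟨hx, hx'⟩
      refine ⟨hx, ?_⟩
      rw [hoR v hv, hx.elim (hoA x) (hoR x), hx']
    · refine add_le_add le_rfl (mul_le_mul_of_nonneg_left ?_ hδ)
      simp
  · intro z hz hzR
    rintro ⟨u, v, α, h1, h2, h3, h4, h5⟩
    rw [hoA v (h.bdry_mem h1.right_mem h2 h3)] at h4
    exact hfar z hz (fun hzR' => by rw [← hoR z hzR']; exact hzR hzR') ⟨u, v, α, h1, h2, h3, h4, h5⟩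
  · intro D hD i hi hiD
    rw [hK] at hi
    rw [hKD D hD] at hiD
    exact haD1 D i hi hiD
  · intro D hD
    have hc := hchild D hD
    refine (hF D hD).2.congr hc.N_sub (fun u hu v hv huv => hc.bdry_mem hu hv huv) ?_
    rintro v (hv | hv)
    · rw [(hF D hD).1 v (hc.disj v hv)]
      exact hv.elim (hoA v) (hoR v)
    · exact ho2 D hD v hv

/-- Every state can be completed to an output. -/
theorem IsState.exists_output [Finite V] (hw : ∀ u v, G.Adj u v → 0 < w u v)
    (hws : ∀ u v, w u v = w v u) (hminor : ¬ HasCliqueMinor G (r + 1)) (hδ : 0 ≤ δ) (hη : 0 < η)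
    {k : ℕ} (hk : 2 * ρ ≤ k * η) (h : IsState G w r δ η C A n o X N a) :
    ∃ o' N', (∀ v, v ∉ C → o' v = o v) ∧
      IsOutput G w r δ η ρ (r * (k + 1)) C A n N a o' N' := by
  classical
  induction hc : C.ncard using Nat.strong_induction_on generalizing C A n o X N a with
  | _ c ih =>
  have ih' : ∀ R : Set V, R ⊆ C → R.Nonempty → ∀ D ∈ comps G (C \ R), ∀ A n o X N a,
      IsState G w r δ η D A n o X N a → ∃ o' N', (∀ v, v ∉ D → o' v = o v) ∧
      IsOutput G w r δ η ρ (r * (k + 1)) D A n N a o' N' := by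
    intro R hRC ⟨y, hy⟩ D hD A n o X N a hs
    refine ih _ ?_ hs rfl
    rw [← hc]
    refine Set.ncard_lt_ncard ((Set.ssubset_iff_of_subset ((comps_sub hD).trans
      Set.sdiff_subset)).2 ⟨y, hRC hy, fun hyD => (comps_sub hD hyD).2 hy⟩) (Set.toFinite _)
  have hKlt := h.ncard_bdryLabels_lt hminor
  have hfin : (bdryLabels G o C).Finite :=
    (Set.finite_Iio n).subset fun i hi => h.bdryLabels_lt hi
  by_cases hB : ∃ z ∈ C, NearBdry G w o C a δ z
  · obtain ⟨z, hz, hzB⟩ := hB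
    obtain ⟨o1, ho1, hg⟩ := exists_growth hw o C a δ
    have hoA : ∀ v, v ∉ C → o1 v = o v := fun v hv => ho1 v fun hv' => hv hv'.1
    set R : Set V := {x | x ∈ C ∧ NearBdry G w o C a δ x} with hR
    have hoA' : ∀ v ∈ A, o1 v = o v := fun v hv => hoA v (h.disj v hv)
    have h1 := h.congr hoA'
    have hK : bdryLabels G o1 C = bdryLabels G o C :=
      bdryLabels_congr (fun u hu v hv huv => h.bdry_mem hu hv huv) hoA'
    have hRC : R ⊆ C := fun v hv => hv.1
    have hlab : ∀ v ∈ R, o1 v ∈ bdryLabels G o1 C := by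
      intro v hv
      obtain ⟨u, hu, s, hs, hus, -, hso, -⟩ := hg v hv.1 hv.2
      exact ⟨u, hu, s, hs, hus, by rw [hoA s hs, hso]⟩
    suffices hext : ∃ o' N', (∀ v, v ∉ C → o' v = o1 v) ∧
        IsOutput G w r δ η ρ (r * (k + 1)) C A n N a o' N' by
      obtain ⟨o', N', h2, h3⟩ := hext
      exact ⟨o', N', fun v hv => (h2 v hv).trans (hoA v hv), h3⟩
    refine h1.extend (R := R) (Net := ∅) (n1 := n) (m := r * (k + 1)) (ρ := ρ)
      hδ hminor hRC (fun v hv => h1.bdryLabels_lt (hlab v hv)) le_rfl (Set.empty_subset _)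
      (Or.inl ⟨rfl, rfl, fun v hv => ⟨hlab v hv, ?_⟩⟩) ?_ ?_ (ih' R hRC ⟨z, hz, hzB⟩)
    · obtain ⟨u, hu, s, hs, hus, -, hso, hws⟩ := hg v hv.1 hv.2
      have hsX := h.bdry u hu s hs hus
      rw [hso] at hsX
      refine ⟨s, hsX, hws.reachableIn.mono ?_⟩
      rintro x (hx | rfl)
      · exact Or.inr hx
      · exact Or.inl hsX
    · intro v hv
      obtain ⟨u, hu, s, hs, hus, has, hso, hws⟩ := hg v hv.1 hv.2
      obtain ⟨t, ht, hts, hst⟩ := h.radius u hu s hs hus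
      refine ⟨t, Or.inl ht, by rw [hoA' t (h.N_sub ht), hts, hso], ?_⟩
      rw [if_pos has, hso] at hst
      rw [hK]
      refine Within.mono (Within.trans (y := s) (hws.mono ?_ le_rfl) (hst.mono ?_ le_rfl)) le_rfl
        (by linarith)
      · rintro x (hx | rfl)
        · exact ⟨Or.inr hx.1, hx.2⟩
        · have hxA := h.bdry_mem hu hs hus
          exact ⟨Or.inl hxA, by rw [hoA' x hxA, hso]⟩
      · rintro x ⟨hx, hx'⟩
        exact ⟨Or.inl hx, by rw [hoA' x hx, hx']⟩
    · rintro y hy hyR ⟨u, v, α, k1, k2, k3, k4, k5⟩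
      have hyB : y ∈ R := by
        rw [hoA v k2] at k4
        exact ⟨hy, u, v, α, k1, k2, k3, k4, k5⟩
      have := h1.bdryLabels_lt (hlab y hyB)
      have := hyR hyB
      omega
  · push Not at hB
    obtain ⟨x, hx⟩ := h.nonempty
    have htouch : ∀ i, ∃ u ∈ C, i ∈ bdryLabels G o C → ∃ p ∈ X i, G.Adj u p := by
      intro i
      by_cases hi : i ∈ bdryLabels G o C
      · obtain ⟨u, hu, v, hv, huv, rfl⟩ := hi
        exact ⟨u, hu, fun _ => ⟨v, h.bdry u hu v hv huv, huv⟩⟩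
      · exact ⟨x, hx, fun h => absurd h hi⟩
    choose f hfC hf using htouch
    set U : Finset V := insert x (hfin.toFinset.image f) with hU
    have hUcard : U.card ≤ r := by
      refine (Finset.card_insert_le _ _).trans ?_
      have := Finset.card_image_le (s := hfin.toFinset) (f := f)
      rw [← Set.ncard_eq_toFinset_card _ hfin] at this
      omega
    obtain ⟨T, Net, hTC, hUT, hTconn, hNetT, hTnet, hcount⟩ := exists_tree_net (ρ := ρ) hw hws hη hk
      h.conn U (by
        intro u hu
        rcases Finset.mem_insert.1 hu with rfl | hu
        · exact hx
        · obtain ⟨i, -, rfl⟩ := Finset.mem_image.1 hu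
          exact hfC i) ⟨x, Finset.mem_insert_self _ _⟩
    obtain ⟨o1, ho1, ho2⟩ : ∃ o1 : V → ℕ, (∀ v, v ∉ T → o1 v = o v) ∧ ∀ v ∈ T, o1 v = n :=
      ⟨fun v => if v ∈ T then n else o v, fun v hv => if_neg hv, fun v hv => if_pos hv⟩
    have hoA' : ∀ v ∈ A, o1 v = o v := fun v hv => ho1 v fun hvT => h.disj v hv (hTC hvT)
    have h1 := h.congr hoA'
    have hK : bdryLabels G o1 C = bdryLabels G o C :=
      bdryLabels_congr (fun u hu v hv huv => h.bdry_mem hu hv huv) hoA'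
    suffices hext : ∃ o' N', (∀ v, v ∉ C → o' v = o1 v) ∧
        IsOutput G w r δ η ρ (r * (k + 1)) C A n N a o' N' by
      obtain ⟨o', N', h2, h3⟩ := hext
      exact ⟨o', N', fun v hv => (h2 v hv).trans (ho1 v fun hvT => hv (hTC hvT)), h3⟩
    refine h1.extend (R := T) (Net := Net) (n1 := n + 1) (m := r * (k + 1))
      (ρ := ρ) hδ hminor hTC (fun v hv => by rw [ho2 v hv]; omega) (Nat.le_succ n) hNetT
      (Or.inr ⟨rfl, ⟨x, hUT x (Finset.mem_insert_self _ _)⟩, ho2, hTconn, ?_, fun z =>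
        (hcount z).trans (Nat.mul_le_mul_right _ hUcard)⟩) ?_ ?_
      (ih' T hTC ⟨x, hUT x (Finset.mem_insert_self _ _)⟩)
    · intro i hi
      rw [hK] at hi
      exact ⟨f i, hUT _ (Finset.mem_insert_of_mem (Finset.mem_image_of_mem f
        (hfin.mem_toFinset.2 hi))), hf i hi⟩
    · intro v hv
      obtain ⟨t, ht, hvt⟩ := hTnet v hv
      refine ⟨t, Or.inr ht, by rw [ho2 v hv, ho2 t (hNetT ht)], hvt.mono ?_ ?_⟩
      · exact fun y hy => ⟨Or.inr hy, by rw [ho2 v hv, ho2 y hy]⟩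
      · rw [hK]
        have := Set.ncard_le_ncard
          (Set.inter_subset_left (s := bdryLabels G o C) (t := Set.Iio (o1 v))) hfin
        have h4 : ((bdryLabels G o C ∩ Set.Iio (o1 v)).ncard : ℝ) ≤ r := by
          exact_mod_cast (this.trans hKlt.le)
        have := mul_nonneg hδ (sub_nonneg.2 h4)
        linarith
    · rintro y hy - ⟨u, v, α, k1, k2, k3, k4, k5⟩
      rw [ho1 v fun hvT => k2 (hTC hvT)] at k4
      exact hB y hy ⟨u, v, α, k1, k2, k3, k4, k5⟩

end Recursion

/-- A labelling of all vertices together with net points, as produced by the recursion. -/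
structure IsDecomposition {V : Type*} (G : SimpleGraph V) (w : V → V → ℝ) (r : ℕ)
    (δ η ρ : ℝ) (m : ℕ) (o : V → ℕ) (N : Set V) : Prop where
  near : ∀ v, ∃ t ∈ N, o t = o v ∧ Within G w {x | o x = o v} v t (η + δ * r)
  few : ∀ z b, b ≤ o z → {i | i < b ∧ AdjLabel G o Set.univ b z i}.ncard < r
  buffer : ∀ z i, i < o z → ¬ AdjLabel G o Set.univ (o z) z i →
    ∃ D : Set V, z ∈ D ∧ (∀ v ∈ D, o v ≠ i) ∧ (∀ u ∈ D, ∀ v, G.Adj u v → o v ≠ i) ∧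
      ∀ u ∈ D, ∀ v, v ∉ D → G.Adj u v → i ≤ o v → ∀ α, Within G w D z u α → δ < α + w u v
  net : ∀ z b, {t | t ∈ N ∧ o t = b ∧ Within G w {x | b ≤ o x} z t ρ}.ncard ≤ m

theorem exists_decomposition {V : Type*} [Finite V] {G : SimpleGraph V} {w : V → V → ℝ} {r : ℕ}
    {δ η ρ : ℝ} (hw : ∀ u v, G.Adj u v → 0 < w u v)
    (hws : ∀ u v, w u v = w v u) (hminor : ¬ HasCliqueMinor G (r + 1)) (hδ : 0 ≤ δ) (hη : 0 < η)
    {k : ℕ} (hk : 2 * ρ ≤ k * η) :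
    ∃ o N, IsDecomposition G w r δ η ρ (r * (k + 1)) o N := by
  classical
  have hb : ∀ D ∈ comps G (Set.univ : Set V), ∀ u ∈ D, ∀ v, v ∉ D → ¬ G.Adj u v :=
    fun D hD u hu v hv huv => hv (comps_closed hD hu huv (Set.mem_univ v))
  have hK : ∀ D ∈ comps G (Set.univ : Set V), ∀ o : V → ℕ, bdryLabels G o D = ∅ := by
    intro D hD o
    ext i
    simp only [Set.mem_empty_iff_false, iff_false]
    rintro ⟨u, hu, v, hv, huv, -⟩
    exact hb D hD u hu v hv huv
  have hst : ∀ D ∈ comps G (Set.univ : Set V),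
      IsState G w r δ η D ∅ 0 (fun _ => 0) (fun _ => ∅) ∅ 0 := by
    intro D hD
    refine ⟨comps_nonempty hD, fun x hx y hy => comps_conn hD hx hy,
      fun u hu v hv huv => absurd huv (hb D hD u hu v hv), by simp, by simp, by simp, by simp, ?_,
      by simp, fun u hu v hv huv => absurd huv (hb D hD u hu v hv)⟩
    rw [hK D hD]; simp
  have hout : ∀ D, ∃ o' N', D ∈ comps G (Set.univ : Set V) →
      IsOutput G w r δ η ρ (r * (k + 1)) D ∅ 0 ∅ 0 o' N' := by
    intro D
    by_cases hD : D ∈ comps G (Set.univ : Set V)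
    · obtain ⟨o', N', -, h⟩ := (hst D hD).exists_output hw hws hminor hδ hη hk
      exact ⟨o', N', fun _ => h⟩
    · exact ⟨fun _ => 0, ∅, fun h => absurd h hD⟩
  choose F ND hF using hout
  obtain ⟨o, ho⟩ : ∃ o : V → ℕ, ∀ D ∈ comps G (Set.univ : Set V), ∀ v ∈ D, o v = F D v := by
    refine ⟨fun v => F {u | ReachableIn G Set.univ v u} v, fun D hD v hv => ?_⟩
    simp only
    rw [← comps_eq hD hv]
  have hO : ∀ D ∈ comps G (Set.univ : Set V),
      IsOutput G w r δ η ρ (r * (k + 1)) D ∅ 0 ∅ 0 o (ND D) := by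
    intro D hD
    refine (hF D hD).congr (Set.empty_subset _)
      (fun u hu v hv huv => absurd huv (hb D hD u hu v hv)) fun v hv => ho D hD v ?_
    simpa using hv
  have hcomp : ∀ z : V, ∃ D ∈ comps G (Set.univ : Set V), z ∈ D := fun z =>
    ⟨_, mem_comps (Set.mem_univ z), ReachableIn.refl (Set.mem_univ z)⟩
  have hclosed : ∀ {D}, D ∈ comps G (Set.univ : Set V) → ∀ {s : Set V}, ∀ u ∈ D, ∀ v,
      G.Adj u v → v ∈ s → v ∈ D := fun hD s u hu v huv _ =>
    comps_closed hD hu huv (Set.mem_univ v)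
  have hal : ∀ {D}, D ∈ comps G (Set.univ : Set V) → ∀ {z}, z ∈ D → ∀ b i,
      (AdjLabel G o Set.univ b z i ↔ AdjLabel G o D b z i) := by
    intro D hD z hz b i
    constructor
    · rintro ⟨u, p, h1, h2, h3⟩
      exact ⟨u, p, (h1.of_closed hz (hclosed hD)).mono fun x hx => ⟨hx.2, hx.1.2⟩, h2, h3⟩
    · rintro ⟨u, p, h1, h2, h3⟩
      exact ⟨u, p, h1.mono fun x hx => ⟨Set.mem_univ x, hx.2⟩, h2, h3⟩
  refine ⟨o, {t | ∃ D ∈ comps G (Set.univ : Set V), t ∈ ND D}, ?_, ?_, ?_, ?_⟩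
  · intro v
    obtain ⟨D, hD, hv⟩ := hcomp v
    obtain ⟨t, ht, h1, h2⟩ := (hO D hD).near v hv
    have ht' : t ∈ ND D := by simpa using ht
    exact ⟨t, ⟨D, hD, ht'⟩, h1, h2.mono (fun x hx => hx.2) le_rfl⟩
  · intro z b hbz
    obtain ⟨D, hD, hz⟩ := hcomp z
    simp only [hal hD hz]
    exact (hO D hD).few z hz b (Nat.zero_le _) hbz
  · intro z i hi hna
    obtain ⟨D, hD, hz⟩ := hcomp z
    rw [hal hD hz] at hna
    obtain ⟨D0, -, h⟩ := (hO D hD).buffer z hz (Nat.zero_le _) i (Or.inr (Nat.zero_le _)) hi hna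
    exact ⟨D0, h⟩
  · intro z b
    obtain ⟨D, hD, hz⟩ := hcomp z
    refine le_trans (Set.ncard_le_ncard ?_ (Set.toFinite _)) ((hO D hD).net z b (Nat.zero_le _))
    rintro t ⟨⟨D', hD', ht⟩, h1, h2⟩
    have h3 := h2.of_closed hz (hclosed hD)
    have h4 := comps_eq hD' ((hO D' hD').N_sub t ht).1
    rw [← comps_eq hD h3.right_mem.2] at h4
    exact ⟨h4 ▸ ht, h1, h3.mono (fun x hx => ⟨hx.2, hx.1⟩) le_rfl⟩

lemma sum_Ioc_two_pow (n : ℕ) : ∑ v ∈ Finset.Ioc 0 n, 2 ^ v + 2 = 2 ^ (n + 1) := by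
  induction n with
  | zero => simp
  | succ n ih =>
    rw [Finset.sum_Ioc_succ_top (Nat.zero_le n)]
    have : 2 ^ (n + 1 + 1) = 2 ^ (n + 1) + 2 ^ (n + 1) := by ring
    omega

lemma potential_drop {r L v0 : ℕ} {c c' : ℕ → ℕ} (hv0 : 0 < v0) (hL : v0 ≤ L)
    (hanti : ∀ v, v ≤ v0 → c' v0 ≤ c' v) (hr : c' v0 ≤ r) (habove : ∀ v, v0 < v → c v ≤ c' v)
    (hat : c v0 + 1 ≤ c' v0) :
    ∑ v ∈ Finset.Ioc 0 L, 2 ^ v * 2 ^ (r - c' v) + 2 ≤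
      ∑ v ∈ Finset.Ioc 0 L, 2 ^ v * 2 ^ (r - c v) := by
  rw [← Finset.sum_Ioc_consecutive _ (Nat.zero_le v0) hL,
    ← Finset.sum_Ioc_consecutive (fun v => 2 ^ v * 2 ^ (r - c v)) (Nat.zero_le v0) hL]
  have h1 : ∑ v ∈ Finset.Ioc v0 L, 2 ^ v * 2 ^ (r - c' v) ≤
      ∑ v ∈ Finset.Ioc v0 L, 2 ^ v * 2 ^ (r - c v) := by
    refine Finset.sum_le_sum fun v hv => Nat.mul_le_mul_left _ (Nat.pow_le_pow_right (by norm_num) ?_)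
    have := habove v (Finset.mem_Ioc.1 hv).1
    omega
  have h2 : ∑ v ∈ Finset.Ioc 0 v0, 2 ^ v * 2 ^ (r - c' v) ≤
      (∑ v ∈ Finset.Ioc 0 v0, 2 ^ v) * 2 ^ (r - c' v0) := by
    rw [Finset.sum_mul]
    refine Finset.sum_le_sum fun v hv => Nat.mul_le_mul_left _ (Nat.pow_le_pow_right (by norm_num) ?_)
    have := hanti v (Finset.mem_Ioc.1 hv).2
    omega
  have h3 : 2 ^ v0 * 2 ^ (r - c v0) ≤ ∑ v ∈ Finset.Ioc 0 v0, 2 ^ v * 2 ^ (r - c v) :=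
    Finset.single_le_sum (f := fun v => 2 ^ v * 2 ^ (r - c v)) (fun _ _ => Nat.zero_le _)
      (Finset.mem_Ioc.2 ⟨hv0, le_rfl⟩)
  have h4 : 2 ^ (r - c' v0 + 1) ≤ 2 ^ (r - c v0) := Nat.pow_le_pow_right (by norm_num) (by omega)
  have h5 := sum_Ioc_two_pow v0
  have h6 : 1 ≤ 2 ^ (r - c' v0) := Nat.one_le_two_pow
  have h7 : 2 ^ v0 * 2 ^ (r - c' v0 + 1) ≤ 2 ^ v0 * 2 ^ (r - c v0) := Nat.mul_le_mul_left _ h4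
  have h8 : 2 ^ v0 * 2 ^ (r - c' v0 + 1) = (∑ v ∈ Finset.Ioc 0 v0, 2 ^ v + 2) * 2 ^ (r - c' v0) := by
    rw [h5]; ring
  rw [add_mul] at h8
  omega

/-- A sequence of sets of bounded size, each obtained from the previous one by adding the next
index and deleting some: if an index of positive depth is only ever deleted in the presence of a
later index of greater depth, then few indices have positive depth. -/
lemma card_pos_depth_le {r L M : ℕ} (K : ℕ → Finset ℕ) (dep : ℕ → ℕ)
    (hlt : ∀ b, ∀ i ∈ K b, i < b) (hsucc : ∀ b < M, K (b + 1) ⊆ insert b (K b))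
    (hcard : ∀ b ≤ M, (K b).card ≤ r) (hL : ∀ i, dep i ≤ L)
    (hloss : ∀ b < M, ∀ i ∈ insert b (K b), i ∉ K (b + 1) → 0 < dep i →
      ∃ j ∈ K (b + 1), i < j ∧ dep i < dep j) :
    ((Finset.range M).filter fun b => 0 < dep b).card ≤ 2 ^ (L + 1 + r) := by
  classical
  let records : ℕ → Finset ℕ := fun b => (K b).filter fun i => ∀ j ∈ K b, i < j → dep j ≤ dep i
  let c : ℕ → ℕ → ℕ := fun b v => ((records b).filter fun i => v ≤ dep i).card
  let Ψ : ℕ → ℕ := fun b => ∑ v ∈ Finset.Ioc 0 L, 2 ^ v * 2 ^ (r - c b v)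
  have hcr : ∀ b ≤ M, ∀ v, c b v ≤ r := fun b hb v =>
    ((Finset.card_filter_le _ _).trans (Finset.card_filter_le _ _)).trans (hcard b hb)
  have hkeep : ∀ b < M, ∀ i ∈ records b, 0 < dep i → i ∉ records (b + 1) →
      b ∈ K (b + 1) ∧ dep i < dep b := by
    intro b hb i hi hdi hni
    obtain ⟨hiK, hrec⟩ := Finset.mem_filter.1 hi
    have : ∃ j ∈ K (b + 1), i < j ∧ dep i < dep j := by
      by_cases hiK' : i ∈ K (b + 1)
      · by_contra hcon
        push Not at hcon
        exact hni (Finset.mem_filter.2 ⟨hiK', hcon⟩)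
      · exact hloss b hb i (Finset.mem_insert_of_mem hiK) hiK' hdi
    obtain ⟨j, hj, hij, hdj⟩ := this
    rcases Finset.mem_insert.1 (hsucc b hb hj) with rfl | hjK
    · exact ⟨hj, hdj⟩
    · exact absurd (hrec j hjK hij) (by omega)
  have hstep : ∀ b < M, Ψ (b + 1) + (if 0 < dep b then 1 else 0) ≤ Ψ b := by
    intro b hb
    by_cases hdb : 0 < dep b
    · have hbK : b ∈ K (b + 1) := by
        by_contra hbK
        obtain ⟨j, hj, hbj, -⟩ := hloss b hb b (Finset.mem_insert_self _ _) hbK hdb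
        have := hlt _ j hj
        omega
      have hbrec : b ∈ records (b + 1) := by
        refine Finset.mem_filter.2 ⟨hbK, fun j hj hbj => ?_⟩
        have := hlt _ j hj
        omega
      have hsub : ∀ v, dep b ≤ v → ((records b).filter fun i => v ≤ dep i) ⊆
          ((records (b + 1)).filter fun i => v ≤ dep i) := by
        intro v hv i hi
        obtain ⟨h1, h2⟩ := Finset.mem_filter.1 hi
        refine Finset.mem_filter.2 ⟨?_, h2⟩
        by_contra hni
        have := (hkeep b hb i h1 (by omega) hni).2
        omega
      have := potential_drop (r := r) (L := L) (c := c b) (c' := c (b + 1)) hdb (hL b)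
        (fun v hv => Finset.card_le_card fun i hi => by
          obtain ⟨h1, h2⟩ := Finset.mem_filter.1 hi
          exact Finset.mem_filter.2 ⟨h1, hv.trans h2⟩)
        (hcr (b + 1) hb _) (fun v hv => Finset.card_le_card (hsub v hv.le)) (by
          have hnb : b ∉ ((records b).filter fun i => dep b ≤ dep i) := by
            intro hmem
            have := hlt _ b (Finset.mem_filter.1 (Finset.mem_filter.1 hmem).1).1
            omega
          change ((records b).filter fun i => dep b ≤ dep i).card + 1 ≤ _
          rw [← Finset.card_insert_of_notMem hnb]
          refine Finset.card_le_card fun i hi => ?_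
          rcases Finset.mem_insert.1 hi with rfl | hi
          · exact Finset.mem_filter.2 ⟨hbrec, le_rfl⟩
          · exact hsub _ le_rfl hi)
      rw [if_pos hdb]
      change _ + 1 ≤ _
      simp only [Ψ]
      omega
    · rw [if_neg hdb, add_zero]
      refine Finset.sum_le_sum fun v hv =>
        Nat.mul_le_mul_left _ (Nat.pow_le_pow_right (by norm_num) (Nat.sub_le_sub_left ?_ _))
      refine Finset.card_le_card fun i hi => ?_
      obtain ⟨h1, h2⟩ := Finset.mem_filter.1 hi
      refine Finset.mem_filter.2 ⟨?_, h2⟩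
      by_contra hni
      have hv0 := (Finset.mem_Ioc.1 hv).1
      have := (hkeep b hb i h1 (by omega) hni).2
      omega
  have hsum : ∀ b ≤ M, Ψ b + ((Finset.range b).filter fun i => 0 < dep i).card ≤ Ψ 0 := by
    intro b
    induction b with
    | zero => intro _; simp
    | succ b ih =>
      intro hb
      have h1 := ih (by omega)
      have h2 := hstep b hb
      rw [Finset.range_add_one, Finset.filter_insert]
      split_ifs with hdb
      · rw [Finset.card_insert_of_notMem (by simp)]
        rw [if_pos hdb] at h2
        omega
      · rw [if_neg hdb] at h2
        omega
  have hΨ0 : Ψ 0 ≤ 2 ^ (L + 1 + r) := by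
    have h1 : Ψ 0 ≤ (∑ v ∈ Finset.Ioc 0 L, 2 ^ v) * 2 ^ r := by
      rw [Finset.sum_mul]
      exact Finset.sum_le_sum fun v _ =>
        Nat.mul_le_mul_left _ (Nat.pow_le_pow_right (by norm_num) (Nat.sub_le _ _))
    have h2 := sum_Ioc_two_pow L
    rw [pow_add 2 (L + 1) r, ← h2]
    exact h1.trans (Nat.mul_le_mul_right _ (by omega))
  have := hsum M le_rfl
  omega

section Count

variable {V : Type*} {G : SimpleGraph V} {w : V → V → ℝ} {r m : ℕ} {δ η ρ : ℝ}
  {o : V → ℕ} {N : Set V}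

/-- Few net points can be reached from `z` by short walks through labels that are not smaller. -/
theorem IsDecomposition.ncard_threats_le [Finite V] (h : IsDecomposition G w r δ η ρ m o N)
    (hw : ∀ u v, G.Adj u v → 0 < w u v) {L : ℕ} (hδ : 0 < δ) (hL : ρ ≤ L * δ) (z : V) :
    {t | t ∈ N ∧ Within G w {x | o t ≤ o x} z t ρ}.ncard ≤ m * (2 ^ (L + 1 + r) + 1) := by
  classical
  let P : ℕ → ℕ → Prop := fun i v => v = 0 ∨ ∃ c p, Within G w {x | i ≤ o x} z c (ρ - (v - 1) * δ) ∧
    G.Adj c p ∧ o p = i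
  let dep : ℕ → ℕ := fun i => Nat.findGreatest (P i) L
  let K : ℕ → Finset ℕ := fun b => (Finset.range b).filter fun i => AdjLabel G o Set.univ b z i
  have hcardK := card_pos_depth_le (r := r) (L := L) (M := o z) K dep
    (fun b i hi => Finset.mem_range.1 (Finset.mem_filter.1 hi).1) ?_ ?_
    (fun i => Nat.findGreatest_le L) ?_
  rotate_left
  · intro b hb i hi
    obtain ⟨h1, u, p, h2, h3⟩ := Finset.mem_filter.1 hi
    have h1' := Finset.mem_range.1 h1
    rcases Nat.lt_succ_iff_lt_or_eq.1 h1' with h4 | rfl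
    · refine Finset.mem_insert_of_mem (Finset.mem_filter.2 ⟨Finset.mem_range.2 h4, u, p,
        h2.mono fun x hx => ⟨hx.1, ?_⟩, h3⟩)
      have := hx.2
      omega
    · exact Finset.mem_insert_self _ _
  · intro b hb
    have h1 := h.few z b hb
    have h2 : {i | i < b ∧ AdjLabel G o Set.univ b z i} = ((K b : Finset ℕ) : Set ℕ) := by
      ext i; simp [K]
    rw [h2, Set.ncard_coe_finset] at h1
    exact h1.le
  · intro b hb i hi hni hdi
    have hib : i ≤ b := by
      rcases Finset.mem_insert.1 hi with rfl | hi
      · exact le_rfl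
      · exact (Finset.mem_range.1 (Finset.mem_filter.1 hi).1).le
    have hno : ∀ u p, ReachableIn G {x | x ∈ Set.univ ∧ b + 1 ≤ o x} z u → G.Adj u p → o p ≠ i :=
      fun u p h1 h2 h3 => hni (Finset.mem_filter.2 ⟨Finset.mem_range.2 (by omega), u, p, h1, h2, h3⟩)
    have hPd : P i (dep i) := Nat.findGreatest_spec (P := P i) (Nat.zero_le L) (Or.inl rfl)
    rcases hPd with h0 | ⟨c, p, hzc, hcp, hpi⟩
    · omega
    set C : Set V := {x | ReachableIn G {x | x ∈ Set.univ ∧ b + 1 ≤ o x} z x} with hC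
    have hzC : z ∈ C := ReachableIn.refl ⟨Set.mem_univ z, hb⟩
    have hcC : c ∉ C := fun hc => hno c p hc hcp hpi
    obtain ⟨u, v, α, β, h1, huC, hvC, hvi, huv, h2, h3⟩ := hzc.exit hzC hcC
    have hou : b + 1 ≤ o u := huC.right_mem.2
    have hov : o v ≤ b := by
      by_contra hcon
      exact hvC (ReachableIn.trans huC (ReachableIn.edge huv huC.right_mem
        ⟨Set.mem_univ v, by omega⟩))
    have hvi' : i < o v := lt_of_le_of_ne hvi (hno u v huC huv).symm
    obtain ⟨D, huD, hD1, hD2, hD3⟩ := h.buffer u i (by omega) (by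
      rintro ⟨x, y, k1, k2, k3⟩
      refine hno x y (ReachableIn.trans huC (k1.mono fun q hq => ⟨hq.1, hou.trans hq.2⟩)) k2 k3)
    have hcD : c ∉ D := fun hc => hD2 c hc p hcp hpi
    have huc : Within G w {x | i ≤ o x} u c (w u v + β) :=
      Within.trans (y := v) (Within.edge huv (by change i ≤ o u; omega) hvi) h2
    obtain ⟨u1, v1, α1, β1, k1, hu1, hv1, hv1i, huv1, k2, k3⟩ := huc.exit huD hcD
    have k4 := hD3 u1 hu1 v1 hv1 huv1 hv1i α1 (k1.mono Set.inter_subset_right le_rfl)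
    have k5 := k2.nonneg hw
    have k6 := h1.nonneg hw
    have hαlt : α ≤ ρ - dep i * δ := by linarith
    have hvL : dep i + 1 ≤ L := by
      have : (dep i : ℝ) * δ < L * δ := by linarith
      exact_mod_cast lt_of_mul_lt_mul_right this hδ.le
    refine ⟨o v, Finset.mem_filter.2 ⟨Finset.mem_range.2 (by omega), u, v, huC, huv, rfl⟩, hvi', ?_⟩
    refine Nat.lt_of_succ_le (Nat.le_findGreatest hvL (Or.inr ⟨u, v, ?_, huv, rfl⟩))
    have k7 : Within G w C z u α := h1.mono Set.inter_subset_right le_rfl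
    refine k7.mono ?_ ?_
    · intro x hx
      have := hx.right_mem.2
      change o v ≤ o x
      omega
    · push_cast
      linarith
  · -- every threat has the label of `z` or a label of positive depth
    set B : Finset ℕ := insert (o z) ((Finset.range (o z)).filter fun b => 0 < dep b) with hB
    have hBcard : B.card ≤ 2 ^ (L + 1 + r) + 1 :=
      (Finset.card_insert_le _ _).trans (Nat.add_le_add_right hcardK 1)
    have hsub : {t | t ∈ N ∧ Within G w {x | o t ≤ o x} z t ρ} ⊆
        ⋃ b ∈ B, {t | t ∈ N ∧ o t = b ∧ Within G w {x | b ≤ o x} z t ρ} := by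
      rintro t ⟨htN, ht⟩
      simp only [Set.mem_iUnion]
      refine ⟨o t, ?_, htN, rfl, ht⟩
      have htz : o t ≤ o z := ht.left_mem
      rcases htz.eq_or_lt with he | hlt
      · rw [he]; exact Finset.mem_insert_self _ _
      · refine Finset.mem_insert_of_mem (Finset.mem_filter.2 ⟨Finset.mem_range.2 hlt, ?_⟩)
        obtain ⟨c, p, α, β, h1, h2, h3, h4, h5, h6, h7⟩ := ht.exit (C := {x | o x ≠ o t})
          (by change o z ≠ o t; omega) (by simp)
        have h8 := h6.nonneg hw
        have h9 := hw c p h5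
        have hα := h1.nonneg hw
        have hL1 : 1 ≤ L := by
          by_contra hcon
          have : L = 0 := by omega
          rw [this] at hL
          simp at hL
          linarith
        refine Nat.lt_of_succ_le (Nat.le_findGreatest hL1 (Or.inr ⟨c, p, ?_, h5, ?_⟩))
        · exact h1.mono Set.inter_subset_left (by push_cast; linarith)
        · simpa using h3
    refine (Set.ncard_le_ncard hsub (Set.toFinite _)).trans
      ((Finset.set_ncard_biUnion_le _ _).trans
        ((Finset.sum_le_sum fun b _ => h.net z b).trans ?_))
    rw [Finset.sum_const, smul_eq_mul, mul_comm]
    exact Nat.mul_le_mul_left _ hBcard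

end Count

section Carve

variable {V : Type*}

/-- A random superlevel set `{y | u ≤ φ y}` with `u` uniform on `(0, 1]`. -/
lemma exists_threshold [Finite V] (φ : V → ℝ) : ∃ μ : PMF (Set V),
    (∀ A ∈ μ.support, ∃ u : ℝ, 0 < u ∧ u ≤ 1 ∧ A = {y | u ≤ φ y}) ∧
    ∀ S : Set (Set V), μ.toOuterMeasure S =
      volume {u : ℝ | u ∈ Set.Ioc 0 1 ∧ {y | u ≤ φ y} ∈ S} := by
  let _ : MeasurableSpace (Set V) := ⊤
  set T : ℝ → Set V := fun u => {y | u ≤ φ y} with hTdef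
  have hT : Measurable T := by
    refine measurable_to_countable' fun A => ?_
    have : T ⁻¹' {A} = ⋂ y, {u | u ≤ φ y ↔ y ∈ A} := by
      ext u
      simp only [Set.mem_preimage, Set.mem_singleton_iff, Set.mem_iInter, T, Set.ext_iff]
      rfl
    rw [this]
    refine MeasurableSet.iInter fun y => ?_
    by_cases hy : y ∈ A
    · simp only [hy, iff_true]
      exact measurableSet_Iic
    · simp only [hy, iff_false, not_le]
      exact measurableSet_Ioi
  have hν : IsProbabilityMeasure (volume.restrict (Set.Ioc (0 : ℝ) 1)) := ⟨by simp⟩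
  have hν' : IsProbabilityMeasure ((volume.restrict (Set.Ioc (0 : ℝ) 1)).map T) :=
    Measure.isProbabilityMeasure_map hT.aemeasurable
  have key : ∀ S : Set (Set V),
      (((volume.restrict (Set.Ioc (0 : ℝ) 1)).map T).toPMF).toOuterMeasure S =
        volume {u : ℝ | u ∈ Set.Ioc 0 1 ∧ {y | u ≤ φ y} ∈ S} := by
    intro S
    rw [← PMF.toMeasure_apply_eq_toOuterMeasure, Measure.toPMF_toMeasure,
      Measure.map_apply hT (by trivial), Measure.restrict_apply (hT (by trivial))]
    congr 1
    ext u
    simp only [Set.mem_inter_iff, Set.mem_preimage, T]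
    exact and_comm
  refine ⟨_, fun A hA => ?_, key⟩
  by_contra hcon
  push Not at hcon
  rw [PMF.mem_support_iff, ← PMF.toOuterMeasure_apply_singleton, key] at hA
  refine hA ?_
  have : {u : ℝ | u ∈ Set.Ioc 0 1 ∧ {y | u ≤ φ y} ∈ ({A} : Set (Set V))} = ∅ := by
    ext u
    simp only [Set.mem_empty_iff_false, iff_false]
    rintro ⟨hu, hA⟩
    exact hcon u hu.1 hu.2 hA.symm
  rw [this, measure_empty]

/-- The law of the random superlevel set `{y | u ≤ φ y}` with `u` uniform on `(0, 1]`. -/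
noncomputable def threshold [Finite V] (φ : V → ℝ) : PMF (Set V) := (exists_threshold φ).choose

open Classical in
/-- Carve random superlevel sets of the given functions out of `V`, one after the other,
and label every point by the first set containing it. -/
noncomputable def carve [Finite V] : List (V → ℝ) → PMF (V → ℕ)
  | [] => PMF.pure 0
  | φ :: l => (threshold φ).bind fun A => (carve l).map fun f y => if y ∈ A then 0 else f y + 1

lemma carve_support [Finite V] {l : List (V → ℝ)} {f : V → ℕ} (hf : f ∈ (carve l).support) {x y : V}
    (hxy : f x = f y) : (∃ φ ∈ l, 0 < φ x ∧ 0 < φ y) ∨ ∀ φ ∈ l, φ x < 1 := by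
  induction l generalizing f with
  | nil => exact Or.inr (by simp)
  | cons φ l ih =>
    simp only [carve, PMF.mem_support_bind_iff, PMF.support_map, Set.mem_image] at hf
    obtain ⟨A, hA, g, hg, rfl⟩ := hf
    obtain ⟨u, hu0, hu1, rfl⟩ := (exists_threshold φ).choose_spec.1 A hA
    by_cases hx : u ≤ φ x
    · have hy : u ≤ φ y := by
        by_contra hy
        simp [hx, hy] at hxy
      exact Or.inl ⟨φ, by simp, by linarith, by linarith⟩
    · have hy : ¬ u ≤ φ y := by
        intro hy
        simp [hx, hy] at hxy
      simp only [Set.mem_ofPred_eq, hx, hy, if_false, Nat.add_right_cancel_iff] at hxy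
      rcases ih hg hxy with ⟨ψ, hψ, h⟩ | h
      · exact Or.inl ⟨ψ, by simp [hψ], h⟩
      · refine Or.inr fun ψ hψ => ?_
        rcases List.mem_cons.1 hψ with rfl | hψ
        · linarith
        · exact h ψ hψ

lemma toOuterMeasure_bind_le {α β : Type*} (p : PMF α) (g : α → PMF β) (S : Set β) (S₁ S₂ : Set α)
    (c : ℝ≥0∞) (h : ∀ a, a ∉ S₁ → (g a).toOuterMeasure S ≤ S₂.indicator (fun _ => c) a) :
    (p.bind g).toOuterMeasure S ≤ p.toOuterMeasure S₁ + p.toOuterMeasure S₂ * c := by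
  rw [PMF.toOuterMeasure_bind_apply, PMF.toOuterMeasure_apply, PMF.toOuterMeasure_apply,
    ← ENNReal.tsum_mul_right, ← ENNReal.tsum_add]
  refine ENNReal.tsum_le_tsum fun a => ?_
  by_cases ha : a ∈ S₁
  · rw [Set.indicator_of_mem ha]
    refine le_add_right ?_
    calc p a * (g a).toOuterMeasure S ≤ p a * (g a).toOuterMeasure Set.univ := by
          gcongr; exact Set.subset_univ _
      _ = p a := by rw [(PMF.toOuterMeasure_apply_eq_one_iff _ _).2 (Set.subset_univ _), mul_one]
  · refine le_add_left ?_
    have := h a ha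
    by_cases ha' : a ∈ S₂
    · rw [Set.indicator_of_mem ha'] at this ⊢
      gcongr
    · rw [Set.indicator_of_notMem ha'] at this
      simp [nonpos_iff_eq_zero.1 this]

lemma carve_cons_cut_le [Finite V] (φ : V → ℝ) (l : List (V → ℝ)) {B : Set V} {a : ℝ} {y₀ : V}
    (ha : ∀ y ∈ B, a ≤ φ y) (hy₀ : y₀ ∈ B) (hb : ∀ y ∈ B, φ y ≤ φ y₀) :
    (carve (φ :: l)).toOuterMeasure {f | ∃ y ∈ B, ∃ y' ∈ B, f y ≠ f y'} ≤
      ENNReal.ofReal (φ y₀ - a) + ENNReal.ofReal (1 - φ y₀) *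
        (carve l).toOuterMeasure {f | ∃ y ∈ B, ∃ y' ∈ B, f y ≠ f y'} := by
  rw [carve]
  refine (toOuterMeasure_bind_le _ _ _ {A | (A ∩ B).Nonempty ∧ (B \ A).Nonempty}
    {A | A ∩ B = ∅} _ fun A hA => ?_).trans (add_le_add ?_ (mul_le_mul_left ?_ _))
  · rw [PMF.toOuterMeasure_map_apply]
    by_cases hAB : A ∩ B = ∅
    · rw [Set.indicator_of_mem (show A ∈ {A | A ∩ B = ∅} from hAB)]
      refine (carve l).toOuterMeasure.mono ?_
      rintro f ⟨y, hy, y', hy', hne⟩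
      have h1 : ∀ y ∈ B, y ∉ A := fun y hy hyA => by
        have : y ∈ A ∩ B := ⟨hyA, hy⟩
        rw [hAB] at this
        exact this
      refine ⟨y, hy, y', hy', ?_⟩
      simpa [h1 y hy, h1 y' hy'] using hne
    · have hBA : B ⊆ A := by
        intro y hy
        by_contra hyA
        exact hA ⟨Set.nonempty_iff_ne_empty.2 hAB, y, hy, hyA⟩
      refine le_of_eq_of_le ?_ zero_le
      refine (congrArg (carve l).toOuterMeasure (Set.eq_empty_iff_forall_notMem.2 ?_)).trans
        (measure_empty (μ := (carve l).toOuterMeasure))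
      intro f
      rintro ⟨y, hy, y', hy', hne⟩
      simp [hBA hy, hBA hy'] at hne
  · rw [threshold, (exists_threshold φ).choose_spec.2, ← Real.volume_Ioc]
    refine measure_mono ?_
    rintro u ⟨-, ⟨y, hyu, hy⟩, y', hy', hyu'⟩
    have h1 : ¬ u ≤ φ y' := hyu'
    have h2 : u ≤ φ y := hyu
    exact ⟨by linarith [ha y' hy'], by linarith [hb y hy]⟩
  · rw [threshold, (exists_threshold φ).choose_spec.2]
    rw [← Real.volume_Ioc]
    refine measure_mono ?_
    rintro u ⟨⟨-, hu1⟩, hu⟩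
    refine ⟨not_le.1 fun hle => ?_, hu1⟩
    have : y₀ ∈ {y | u ≤ φ y} ∩ B := ⟨hle, hy₀⟩
    rw [hu] at this
    exact this

/-- If the functions that are relevant for `B` are few and have small oscillation on `B` relative
to their size, then `B` is unlikely to be cut by the partition carved out with them. -/
lemma carve_cut_le [Finite V] {B : Set V} (hB : B.Nonempty) {a ε : ℝ} (ha : 0 ≤ a) (hε : 0 ≤ ε)
    {ι : Type*} (φ : ι → V → ℝ) (h0 : ∀ i, ∀ y ∈ B, 0 ≤ φ i y) (h1 : ∀ i, ∀ y ∈ B, φ i y ≤ 1)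
    (p : ι → Prop) [DecidablePred p] (T : List ι) (n : ℕ) (hn : T.countP p ≤ n)
    (h : ∀ l₁ i l₂, T = l₁ ++ i :: l₂ → (∀ j ∈ l₁, ∀ y ∈ B, φ j y < 1) → (∃ y ∈ B, 0 < φ i y) →
      p i ∧ ∀ y ∈ B, ∀ y' ∈ B, φ i y - φ i y' ≤ a * (φ i y + ε)) :
    (carve (T.map φ)).toOuterMeasure {f | ∃ y ∈ B, ∃ y' ∈ B, f y ≠ f y'} ≤
      ENNReal.ofReal (a * (1 + ε * n)) := by
  induction T generalizing n with
  | nil => simp [carve, PMF.toOuterMeasure_pure_apply]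
  | cons i T ih =>
    obtain ⟨y₀, hy₀, hmax⟩ := B.toFinite.exists_maximalFor (φ i) B hB
    obtain ⟨y₁, hy₁, hmin⟩ := B.toFinite.exists_minimalFor (φ i) B hB
    replace hmax : ∀ y ∈ B, φ i y ≤ φ i y₀ := fun y hy => by
      by_contra hcon
      exact hcon (hmax hy (not_le.1 hcon).le)
    replace hmin : ∀ y ∈ B, φ i y₁ ≤ φ i y := fun y hy => by
      by_contra hcon
      exact hcon (hmin hy (not_le.1 hcon).le)
    rw [List.map_cons]
    refine (carve_cons_cut_le (φ i) (T.map φ) hmin hy₀ hmax).trans ?_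
    have e0 := h0 i y₀ hy₀
    have e1 := h1 i y₀ hy₀
    have e2 := h0 i y₁ hy₁
    have ih' := fun n hn (hlt : φ i y₀ < 1) => ih n hn fun l₁ j l₂ hl hl₁ hj => by
      refine h (i :: l₁) j l₂ (by simp [hl]) ?_ hj
      intro k hk y hy
      rcases List.mem_cons.1 hk with rfl | hk
      · exact (hmax y hy).trans_lt hlt
      · exact hl₁ k hk y hy
    by_cases hhit : ∃ y ∈ B, 0 < φ i y
    · obtain ⟨hp, hosc⟩ := h [] i T rfl (by simp) hhit
      replace hosc := hosc y₀ hy₀ y₁ hy₁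
      rw [List.countP_cons_of_pos (by simpa using hp)] at hn
      obtain ⟨n, rfl⟩ : ∃ k, n = k + 1 := ⟨n - 1, by omega⟩
      have hεn : 0 ≤ ε * n := by positivity
      rcases e1.eq_or_lt with he | hlt
      · rw [he, sub_self, ENNReal.ofReal_zero, zero_mul, add_zero]
        refine ENNReal.ofReal_le_ofReal ?_
        push_cast
        rw [he] at hosc
        nlinarith
      · refine (add_le_add_right (mul_le_mul_right (ih' n (by omega) hlt) _) _).trans ?_
        rw [← ENNReal.ofReal_mul (by linarith), ← ENNReal.ofReal_add (by linarith [hmin y₀ hy₀])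
          (by have : 0 ≤ 1 - φ i y₀ := by linarith
              positivity)]
        refine ENNReal.ofReal_le_ofReal ?_
        push_cast
        nlinarith [mul_nonneg (mul_nonneg ha hεn) e0]
    · have hz : φ i y₀ = 0 := le_antisymm (not_lt.1 fun hlt => hhit ⟨y₀, hy₀, hlt⟩) e0
      have hn' : T.countP p ≤ n := le_trans (by rw [List.countP_cons]; omega) hn
      refine (add_le_add_right (mul_le_mul_right (ih' n hn' (by linarith)) _) _).trans ?_
      rw [hz, ENNReal.ofReal_of_nonpos (by linarith : (0 : ℝ) - φ i y₁ ≤ 0)]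
      simp

end Carve

/-- A truncated exponential profile: equal to `1` up to `ρ`, decaying exponentially at rate `c`
afterwards, and equal to `0` from `ρ + ℓ` on. -/
noncomputable def profile (c ρ ℓ x : ℝ) : ℝ :=
  max 0 ((exp (-(c * (max x ρ - ρ))) - exp (-(c * ℓ))) / (1 - exp (-(c * ℓ))))

section Profile

variable {c ρ ℓ x y : ℝ}

lemma one_sub_exp_pos (hc : 0 < c) (hℓ : 0 < ℓ) : 0 < 1 - exp (-(c * ℓ)) := by
  have : exp (-(c * ℓ)) < 1 := by
    rw [← exp_zero]
    exact exp_lt_exp.2 (by have := mul_pos hc hℓ; linarith)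
  linarith

lemma profile_nonneg : 0 ≤ profile c ρ ℓ x := le_max_left _ _

lemma profile_le_one (hc : 0 < c) (hℓ : 0 < ℓ) : profile c ρ ℓ x ≤ 1 := by
  refine max_le zero_le_one ((div_le_one (one_sub_exp_pos hc hℓ)).2 ?_)
  have : exp (-(c * (max x ρ - ρ))) ≤ 1 := by
    refine exp_le_one_iff.2 ?_
    have := mul_nonneg hc.le (sub_nonneg.2 (le_max_right x ρ))
    linarith
  linarith

lemma profile_eq_one (hc : 0 < c) (hℓ : 0 < ℓ) (hx : x ≤ ρ) : profile c ρ ℓ x = 1 := by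
  rw [profile, max_eq_right hx, sub_self, mul_zero, neg_zero, exp_zero,
    div_self (one_sub_exp_pos hc hℓ).ne']
  simp

lemma lt_of_profile_pos (hc : 0 < c) (hℓ : 0 < ℓ) (hx : 0 < profile c ρ ℓ x) : x < ρ + ℓ := by
  rcases lt_max_iff.1 hx with h | h
  · exact absurd h (lt_irrefl _)
  · have h1 := (div_pos_iff_of_pos_right (one_sub_exp_pos hc hℓ)).1 h
    have h2 := exp_lt_exp.1 (sub_pos.1 h1)
    have h3 := lt_of_mul_lt_mul_left (neg_lt_neg_iff.1 h2) hc.le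
    linarith [le_max_left x ρ]

lemma profile_sub_le (hc : 0 < c) (hℓ : 0 < ℓ) {σ : ℝ} (hσ : 0 ≤ σ) (hxy : y ≤ x + σ) :
    profile c ρ ℓ x - profile c ρ ℓ y ≤
      (1 - exp (-(c * σ))) * (profile c ρ ℓ x + exp (-(c * ℓ)) / (1 - exp (-(c * ℓ)))) := by
  have hp := one_sub_exp_pos hc hℓ
  have h1 : 0 ≤ 1 - exp (-(c * σ)) := by
    have : exp (-(c * σ)) ≤ 1 := exp_le_one_iff.2 (by have := mul_nonneg hc.le hσ; linarith)
    linarith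
  rcases (profile_nonneg (c := c) (ρ := ρ) (ℓ := ℓ) (x := x)).eq_or_lt with h | h
  · rw [← h]
    have := profile_nonneg (c := c) (ρ := ρ) (ℓ := ℓ) (x := y)
    have : 0 ≤ (1 - exp (-(c * σ))) * (0 + exp (-(c * ℓ)) / (1 - exp (-(c * ℓ)))) := by positivity
    linarith
  · have hx : profile c ρ ℓ x =
        (exp (-(c * (max x ρ - ρ))) - exp (-(c * ℓ))) / (1 - exp (-(c * ℓ))) := by
      refine max_eq_right (le_of_lt ?_)
      rcases lt_max_iff.1 h with h | h
      · exact absurd h (lt_irrefl _)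
      · exact h
    have hy : (exp (-(c * (max y ρ - ρ))) - exp (-(c * ℓ))) / (1 - exp (-(c * ℓ))) ≤
        profile c ρ ℓ y := le_max_right _ _
    have hmax : max y ρ ≤ max x ρ + σ :=
      max_le (hxy.trans (by linarith [le_max_left x ρ])) (by linarith [le_max_right x ρ])
    have hE : exp (-(c * σ)) * exp (-(c * (max x ρ - ρ))) ≤ exp (-(c * (max y ρ - ρ))) := by
      rw [← exp_add]
      refine exp_le_exp.2 ?_
      nlinarith
    have hx' : profile c ρ ℓ x + exp (-(c * ℓ)) / (1 - exp (-(c * ℓ))) =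
        exp (-(c * (max x ρ - ρ))) / (1 - exp (-(c * ℓ))) := by
      rw [hx, ← add_div]; congr 1; ring
    rw [hx']
    refine (sub_le_sub_left hy _).trans ?_
    rw [hx, ← sub_div, ← mul_div_assoc]
    refine div_le_div_of_nonneg_right ?_ hp.le
    linarith

end Profile

section Potential

variable {V : Type*} {G : SimpleGraph V} {w : V → V → ℝ} {s : Set V} {t x y z : V}
  {c ρ ℓ σ : ℝ}

open Classical in
/-- The profile evaluated at the distance to `t` inside `s`. -/
noncomputable def potential (G : SimpleGraph V) (w : V → V → ℝ) (c ρ ℓ : ℝ) (s : Set V) (t y : V) :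
    ℝ :=
  if dIn G w s y t = ⊤ then 0 else profile c ρ ℓ (dIn G w s y t).toReal

lemma potential_nonneg : 0 ≤ potential G w c ρ ℓ s t y := by
  rw [potential]; split_ifs
  exacts [le_rfl, profile_nonneg]

lemma potential_le_one (hc : 0 < c) (hℓ : 0 < ℓ) : potential G w c ρ ℓ s t y ≤ 1 := by
  rw [potential]; split_ifs
  exacts [zero_le_one, profile_le_one hc hℓ]

lemma within_toReal [Finite V] (hw : ∀ u v, G.Adj u v → 0 < w u v) (h : dIn G w s x y ≠ ⊤) :
    Within G w s x y (dIn G w s x y).toReal :=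
  (dIn_le_iff hw ENNReal.toReal_nonneg).1 (ENNReal.ofReal_toReal h).ge

lemma Within.dIn_ne_top [Finite V] (hw : ∀ u v, G.Adj u v → 0 < w u v)
    (h : Within G w s x y ρ) : dIn G w s x y ≠ ⊤ :=
  ((dIn_le_iff hw (h.nonneg hw)).2 h).trans_lt ENNReal.ofReal_lt_top |>.ne

lemma Within.toReal_dIn_le [Finite V] (hw : ∀ u v, G.Adj u v → 0 < w u v)
    (h : Within G w s x y ρ) : (dIn G w s x y).toReal ≤ ρ :=
  ENNReal.toReal_le_of_le_ofReal (h.nonneg hw) ((dIn_le_iff hw (h.nonneg hw)).2 h)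

lemma potential_eq_one [Finite V] (hw : ∀ u v, G.Adj u v → 0 < w u v) (hc : 0 < c) (hℓ : 0 < ℓ)
    (h : Within G w s y t ρ) : potential G w c ρ ℓ s t y = 1 := by
  rw [potential, if_neg (h.dIn_ne_top hw), profile_eq_one hc hℓ (h.toReal_dIn_le hw)]

lemma within_of_potential_pos [Finite V] (hw : ∀ u v, G.Adj u v → 0 < w u v) (hc : 0 < c)
    (hℓ : 0 < ℓ) (h : 0 < potential G w c ρ ℓ s t y) : Within G w s y t (ρ + ℓ) := by
  rw [potential] at h
  split_ifs at h with htop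
  · exact absurd h (lt_irrefl _)
  · exact (within_toReal hw htop).mono subset_rfl (lt_of_profile_pos hc hℓ h).le

lemma potential_sub_le [Finite V] (hw : ∀ u v, G.Adj u v → 0 < w u v) (hc : 0 < c) (hℓ : 0 < ℓ)
    (h : Within G w s y x σ) :
    potential G w c ρ ℓ s t x - potential G w c ρ ℓ s t y ≤
      (1 - exp (-(c * σ))) *
        (potential G w c ρ ℓ s t x + exp (-(c * ℓ)) / (1 - exp (-(c * ℓ)))) := by
  have hσ := h.nonneg hw
  by_cases htop : dIn G w s x t = ⊤
  · have h0 : potential G w c ρ ℓ s t x = 0 := by rw [potential, if_pos htop]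
    have h1 : exp (-(c * σ)) ≤ 1 := exp_le_one_iff.2 (by have := mul_nonneg hc.le hσ; linarith)
    have h2 := one_sub_exp_pos hc hℓ
    have h3 : 0 ≤ (1 - exp (-(c * σ))) * (0 + exp (-(c * ℓ)) / (1 - exp (-(c * ℓ)))) :=
      mul_nonneg (by linarith) (by positivity)
    rw [h0]
    linarith [potential_nonneg (G := G) (w := w) (c := c) (ρ := ρ) (ℓ := ℓ) (s := s) (t := t) (y := y)]
  · have h1 := h.trans (within_toReal hw htop)
    rw [potential, if_neg htop, potential, if_neg (h1.dIn_ne_top hw)]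
    exact profile_sub_le hc hℓ hσ ((h1.toReal_dIn_le hw).trans (add_comm _ _).le)

lemma mem_gball [Finite V] (hw : ∀ u v, G.Adj u v → 0 < w u v) (hσ : 0 ≤ σ) :
    y ∈ gball G w z σ ↔ Within G w Set.univ z y σ := dIn_le_iff hw hσ

/-- Balls are star-shaped around their centres. -/
lemma within_gball [Finite V] (hw : ∀ u v, G.Adj u v → 0 < w u v) (hσ : 0 ≤ σ)
    (h : y ∈ gball G w z σ) : Within G w (gball G w z σ) z y σ := by
  obtain ⟨p, -, hp⟩ := (mem_gball hw hσ).1 h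
  refine ⟨p, fun v hv => (mem_gball hw hσ).2 ?_, hp⟩
  obtain ⟨p₁, p₂, rfl⟩ := walk_split p hv
  refine ⟨p₁, fun _ _ => Set.mem_univ _, ?_⟩
  rw [walkWeight_append] at hp
  linarith [walkWeight_nonneg hw p₂]

end Potential

section Assembly

variable {V : Type*} {G : SimpleGraph V} {w : V → V → ℝ} {r m : ℕ} {δ η ρ : ℝ}
  {o : V → ℕ} {N : Set V}

/-- A decomposition can be carved into random clusters of small diameter that seldom cut
small balls. -/
theorem IsDecomposition.exists_random_partition [Finite V] (h : IsDecomposition G w r δ η ρ m o N)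
    (hw : ∀ u v, G.Adj u v → 0 < w u v) (hws : ∀ u v, w u v = w v u) {L : ℕ} (hδ : 0 < δ)
    (hL : ρ ≤ L * δ) {c ℓ : ℝ} (hc : 0 < c) (hℓ : 0 < ℓ) :
    ∃ μ : PMF (V → ℕ),
      (∀ f ∈ μ.support, ∀ x y : V, f x = f y →
        dG G w x y ≤ ENNReal.ofReal (2 * (η + δ * r + ℓ))) ∧
      ∀ (z : V) (σ : ℝ), 0 ≤ σ → η + δ * r + ℓ + σ ≤ ρ →
        μ.toOuterMeasure {f | ¬ gball G w z σ ⊆ {y | f y = f z}} ≤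
          ENNReal.ofReal ((1 - exp (-(c * (2 * σ)))) *
            (1 + exp (-(c * ℓ)) / (1 - exp (-(c * ℓ))) * (m * (2 ^ (L + 1 + r) + 1) : ℕ))) := by
  classical
  let φ : V → V → ℝ := fun t => potential G w c (η + δ * r) ℓ {x | o t ≤ o x} t
  let T : List V := N.toFinite.toFinset.toList.insertionSort fun s t => o s ≤ o t
  have hT : ∀ t, t ∈ T ↔ t ∈ N := by simp [T]
  have hTnd : T.Nodup := (List.perm_insertionSort _ _).nodup_iff.2 (Finset.nodup_toList _)
  have hTs : T.Pairwise fun s t => o s ≤ o t :=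
    List.pairwise_insertionSort (r := fun s t => o s ≤ o t) _
  have hone : ∀ v, ∃ t ∈ N, o t = o v ∧ φ t v = 1 := fun v => by
    obtain ⟨t, htN, hto, ht⟩ := h.near v
    refine ⟨t, htN, hto, potential_eq_one hw hc hℓ ?_⟩
    exact ht.mono (fun x hx => (hto.trans hx.symm).le) le_rfl
  have hsub : ∀ (z : V) {σ : ℝ}, 0 ≤ σ → ∀ y ∈ gball G w z σ, ∀ y' ∈ gball G w z σ,
      Within G w (gball G w z σ) y y' (2 * σ) := fun z σ hσ y hy y' hy' =>
    ((within_gball hw hσ hy).symm hws |>.trans (within_gball hw hσ hy')).mono subset_rfl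
      (by linarith)
  refine ⟨carve (T.map φ), fun f hf x y hxy => ?_, fun z σ hσ hρ => ?_⟩
  · rcases carve_support hf hxy with ⟨ψ, hψ, hx, hy⟩ | hcon
    · obtain ⟨t, -, rfl⟩ := List.mem_map.1 hψ
      have hx' := within_of_potential_pos hw hc hℓ hx
      have hy' := within_of_potential_pos hw hc hℓ hy
      have hxy := (hx'.trans (hy'.symm hws)).mono (Set.subset_univ _) (two_mul _).ge
      exact (dIn_le_iff hw (hxy.nonneg hw)).2 hxy
    · obtain ⟨t, htN, -, ht⟩ := hone x
      exact absurd ht (hcon (φ t) (List.mem_map.2 ⟨t, (hT t).2 htN, rfl⟩)).ne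
  · set B := gball G w z σ with hB
    have hz : z ∈ B := (mem_gball hw hσ).2 (Within.refl (Set.mem_univ z) hσ)
    refine le_trans ((carve (T.map φ)).toOuterMeasure.mono ?_) (carve_cut_le (B := B) ⟨z, hz⟩
      (a := 1 - exp (-(c * (2 * σ)))) (ε := exp (-(c * ℓ)) / (1 - exp (-(c * ℓ)))) ?_ ?_
      φ (fun _ _ _ => potential_nonneg) (fun _ _ _ => potential_le_one hc hℓ)
      (fun t => B ⊆ {x | o t ≤ o x} ∧ ∃ y ∈ B, 0 < φ t y) T _ ?_ ?_)
    · intro f hf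
      obtain ⟨y, hy, hne⟩ := Set.not_subset.1 hf
      exact ⟨y, hy, z, hz, hne⟩
    · have : exp (-(c * (2 * σ))) ≤ 1 := by
        refine exp_le_one_iff.2 ?_
        have := mul_nonneg hc.le hσ
        linarith
      linarith
    · have := one_sub_exp_pos hc hℓ
      positivity
    · refine le_trans ?_ (h.ncard_threats_le hw hδ hL z)
      rw [List.countP_eq_length_filter, ← List.toFinset_card_of_nodup
        (hTnd.filter _), ← Set.ncard_coe_finset]
      refine Set.ncard_le_ncard ?_ (Set.toFinite _)
      intro t ht
      simp only [List.coe_toFinset, List.mem_filter, decide_eq_true_eq, Set.mem_ofPred_eq] at ht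
      obtain ⟨htT, hge, y, hy, hpos⟩ := ht
      refine ⟨(hT t).1 htT, (((within_gball hw hσ hy).mono hge le_rfl).trans
        (within_of_potential_pos hw hc hℓ hpos)).mono subset_rfl ?_⟩
      linarith
    · intro l₁ t l₂ hl hl₁ hhit
      have hge : B ⊆ {x | o t ≤ o x} := by
        intro x hx
        obtain ⟨s, hsN, hso, hs⟩ := hone x
        change o t ≤ o x
        rw [← hso]
        have hsT := (hT s).2 hsN
        rw [hl] at hsT hTs
        rcases List.mem_append.1 hsT with hs1 | hs2
        · exact absurd hs (hl₁ s hs1 x hx).ne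
        · rcases List.mem_cons.1 hs2 with rfl | hs2
          · exact le_rfl
          · exact (List.pairwise_cons.1 (List.pairwise_append.1 hTs).2.1).1 s hs2
      exact ⟨⟨hge, hhit⟩, fun y hy y' hy' =>
        potential_sub_le hw hc hℓ ((hsub z hσ y' hy' y hy).mono hge le_rfl)⟩

end Assembly

lemma mul_pow_sixteen_le {r : ℕ} (hr : 4 ≤ r) : 924 * r * 16 ^ r ≤ 140 ^ r := by
  induction r, hr using Nat.le_induction with
  | base => norm_num
  | succ r hr ih =>
    calc 924 * (r + 1) * 16 ^ (r + 1) = 16 * (924 * (r + 1) * 16 ^ r) := by ring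
      _ ≤ 16 * (924 * (2 * r) * 16 ^ r) := by gcongr; omega
      _ = 32 * (924 * r * 16 ^ r) := by ring
      _ ≤ 140 * 140 ^ r := Nat.mul_le_mul (by norm_num) ih
      _ = 140 ^ (r + 1) := by ring

lemma threat_count_le {r : ℕ} (hr : 4 ≤ r) :
    14 * ((r * 22 * (2 ^ (3 * r + 1 + r) + 1) : ℕ) : ℝ) * exp (-(7 * r)) ≤ exp (-(7 / 4 * r)) := by
  have h1 : 14 * (r * 22 * (2 ^ (3 * r + 1 + r) + 1)) ≤ 140 ^ r := by
    refine le_trans ?_ (mul_pow_sixteen_le hr)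
    have h2 : 2 ^ (3 * r + 1 + r) = 2 * 16 ^ r := by
      rw [show (16 : ℕ) = 2 ^ 4 by norm_num, ← pow_mul]; ring
    rw [h2]
    have := Nat.one_le_pow r 16 (by norm_num)
    nlinarith [Nat.mul_le_mul_left r this]
  have h2 : (14 : ℝ) * ((r * 22 * (2 ^ (3 * r + 1 + r) + 1) : ℕ) : ℝ) ≤ 140 ^ r := by
    exact_mod_cast h1
  have h3 : (140 : ℝ) ^ r ≤ exp (5 * r) := by
    rw [mul_comm, exp_nat_mul]
    refine pow_le_pow_left₀ (by norm_num) ?_ r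
    have h4 : exp 5 = exp 1 ^ 5 := by rw [← exp_nat_mul]; norm_num
    rw [h4]
    have h5 : (2.7 : ℝ) ≤ exp 1 := exp_one_gt_d9.le.trans' (by norm_num)
    exact (pow_le_pow_left₀ (by norm_num) h5 5).trans' (by norm_num)
  calc _ ≤ exp (5 * r) * exp (-(7 * r)) := by gcongr; exact h2.trans h3
    _ = exp (-(2 * r)) := by rw [← exp_add]; congr 1; ring
    _ ≤ _ := exp_le_exp.2 (by have : (0 : ℝ) ≤ r := by positivity
                              linarith)

lemma cut_bound_le {r : ℕ} (hr : 4 ≤ r) {γ : ℝ} (hγ0 : 0 ≤ γ) (hγ : γ ≤ 1 / 40) :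
    (1 - exp (-(70 * r * γ))) * (1 + exp (-(7 * r)) / (1 - exp (-(7 * r))) *
      (r * 22 * (2 ^ (3 * r + 1 + r) + 1) : ℕ)) ≤ 1 - exp (-(80 * r * γ)) := by
  have hr' : (4 : ℝ) ≤ r := by exact_mod_cast hr
  set x := exp (-(10 * r * γ)) with hx
  have hx0 : 0 < x := exp_pos _
  have hrγ : 0 ≤ r * γ := by positivity
  have hx1 : x ≤ 1 := exp_le_one_iff.2 (by linarith)
  have h7 : exp (-(70 * r * γ)) = x ^ 7 := by rw [hx, ← exp_nat_mul]; congr 1; push_cast; ring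
  have h8 : exp (-(80 * r * γ)) = x ^ 8 := by rw [hx, ← exp_nat_mul]; congr 1; push_cast; ring
  have hlow : exp (-(7 / 4 * r)) ≤ x ^ 7 := by
    rw [← h7]
    refine exp_le_exp.2 ?_
    nlinarith
  have hκ : exp (-(7 * r)) ≤ 1 / 2 := by
    have h1 : 2 ≤ exp (7 * r) := by
      have := add_one_le_exp (7 * r : ℝ)
      linarith
    rw [exp_neg, ← one_div]
    exact one_div_le_one_div_of_le (by norm_num) h1
  have hcount := threat_count_le hr
  set M : ℝ := ((r * 22 * (2 ^ (3 * r + 1 + r) + 1) : ℕ) : ℝ)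
  have hM : 0 ≤ M := Nat.cast_nonneg _
  set κ := exp (-(7 * r))
  have hκ0 : 0 < κ := exp_pos _
  have hε : 7 * (κ / (1 - κ) * M) ≤ x ^ 7 := by
    refine le_trans ?_ (hcount.trans hlow)
    have : κ / (1 - κ) ≤ 2 * κ := by
      rw [div_le_iff₀ (by linarith)]
      nlinarith
    nlinarith
  have hbern : 1 - x ^ 7 ≤ 7 * (1 - x) := by
    have := one_add_mul_le_pow (a := x - 1) (by linarith) 7
    push_cast at this
    rw [add_sub_cancel] at this
    linarith
  have hεM : 0 ≤ κ / (1 - κ) * M := mul_nonneg (div_nonneg hκ0.le (by linarith)) hM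
  rw [h7, h8]
  nlinarith [mul_le_mul_of_nonneg_right hbern hεM, mul_le_mul_of_nonneg_left hε (sub_nonneg.2 hx1)]

/-- Lemma 4.3 / `lem:weak-cut-prob` with Claim 4.2.
Let `r ≥ 4` and let `G` be a finite edge-weighted graph excluding `K_{r+1}` as a minor,
`Δ > 0`.  Then there is a distribution over partitions of `V` (encoded by
cluster-labelling functions `f : V → ℕ`) whose clusters have weak diameter at most `Δ`,
such that for every vertex `z` and every `0 ≤ γ ≤ 1/40`, the probability that the ball
`B_G(z, γΔ)` is cut (not contained in a single cluster) is at most `1 - e^{-80rγ}`. -/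
theorem weak_partition_cut_probability
    (r : ℕ) (hr : 4 ≤ r)
    (V : Type) [Fintype V] (G : SimpleGraph V) (w : V → V → ℝ)
    (hw : ∀ u v, G.Adj u v → 0 < w u v) (hws : ∀ u v, w u v = w v u)
    (hminor : ¬ HasCliqueMinor G (r + 1))
    (Δ : ℝ) (hΔ : 0 < Δ) :
    ∃ μ : PMF (V → ℕ),
      (∀ f ∈ μ.support, ∀ x y : V, f x = f y → dG G w x y ≤ ENNReal.ofReal Δ) ∧
      ∀ (z : V) (γ : ℝ), 0 ≤ γ → γ ≤ 1/40 →
        μ.toOuterMeasure {f | ¬ gball G w z (γ * Δ) ⊆ {y | f y = f z}} ≤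
          ENNReal.ofReal (1 - Real.exp (-(80 * r * γ))) := by
  have hr' : (0 : ℝ) < r := by exact_mod_cast (by omega : 0 < r)
  have hδ : 0 < Δ / (4 * r) := by positivity
  have hδr : Δ / (4 * r) * r = Δ / 4 := by field_simp
  obtain ⟨o, N, h⟩ := exists_decomposition (δ := Δ / (4 * r)) (η := Δ / 20) (ρ := 21 / 40 * Δ)
    (k := 21) hw hws hminor hδ.le (by positivity) (by push_cast; linarith)
  obtain ⟨μ, hdiam, hcut⟩ := h.exists_random_partition hw hws (L := 3 * r) (c := 35 * r / Δ)
    (ℓ := Δ / 5) hδ (by push_cast; nlinarith) (by positivity) (by positivity)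
  rw [hδr] at hdiam hcut
  refine ⟨μ, fun f hf x y hxy => (hdiam f hf x y hxy).trans (ENNReal.ofReal_le_ofReal (by linarith)),
    fun z γ hγ0 hγ => (hcut z (γ * Δ) (by positivity) (by nlinarith)).trans
      (ENNReal.ofReal_le_ofReal (le_trans (le_of_eq ?_) (cut_bound_le hr hγ0 hγ)))⟩
  rw [show 35 * (r : ℝ) / Δ * (2 * (γ * Δ)) = 70 * r * γ by field_simp; ring,
    show 35 * (r : ℝ) / Δ * (Δ / 5) = 7 * r by field_simp; ring]

end KPRpaper
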